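/- arXiv:1709.04276 — 2 statements merged into one kernel-verified Lean document; each statement's English description precedes it below -/
import Mathlib

section
/- Let λ, μ ∈ ℝ, let r ∈ (0,1) and C₀ > 0, and let c : ℕ → ℂ satisfy |c_k| ≤ C₀ r^k for all k, together with the stationary-wave equations: for every k ∈ ℕ, (λ + μ k) c_k = (1/(2π)) Σ_{ℓ,m,n ≥ 0, k+ℓ = m+n} ((k+ℓ)!/(2^{k+ℓ} √(k! ℓ! m! n!))) \overline{c_ℓ} c_m c_n (the sum converging absolutely). Then for every γ < (1/2)·(log 2 / log 3) there exists C > 0 such that |c_k| ≤ C k^{−γ k} for all k ≥ 1. -/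
/-- The interaction coefficient `(k+ℓ)! / (2^{k+ℓ} √(k! ℓ! m! n!))`. -/
noncomputable def LLLcoef (k l m n : ℕ) : ℝ :=
  ((k + l).factorial : ℝ) /
    (2 ^ (k + l) * Real.sqrt ((k.factorial : ℝ) * l.factorial * m.factorial * n.factorial))

/-- The `k`-th term of the LLL nonlinearity in coefficients, as a sum over triples
`(ℓ,m,n)` with `k + ℓ = m + n`. -/
noncomputable def LLLterm (c : ℕ → ℂ) (k : ℕ) (t : ℕ × ℕ × ℕ) : ℂ :=
  if k + t.1 = t.2.1 + t.2.2 then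
    ((LLLcoef k t.1 t.2.1 t.2.2 : ℝ) : ℂ) * (starRingEnd ℂ) (c t.1) * c t.2.1 * c t.2.2
  else 0

lemma choose_weight (p q : ℝ) (hpq : p ^ 2 + q ^ 2 ≤ 2) (k l : ℕ) :
    ((k + l).choose k : ℝ) * (q ^ 2) ^ k * (p ^ 2) ^ l ≤ 2 ^ (k + l) := by
  have h1 : (q ^ 2 + p ^ 2) ^ (k + l) ≤ 2 ^ (k + l) :=
    pow_le_pow_left₀ (by positivity) (by linarith) _
  refine le_trans ?_ h1
  rw [add_pow]
  have := Finset.single_le_sum (s := Finset.range (k + l + 1))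
    (f := fun m => (q ^ 2) ^ m * (p ^ 2) ^ (k + l - m) * ((k + l).choose m : ℝ))
    (fun i _ => by positivity) (Finset.mem_range.mpr (by omega : k < k + l + 1))
  simp only [Nat.add_sub_cancel_left] at this
  linarith

lemma LLLcoef_nonneg (k l m n : ℕ) : 0 ≤ LLLcoef k l m n := by
  unfold LLLcoef; positivity

lemma LLLcoef_sq (k l m n : ℕ) (h : k + l = m + n) :
    LLLcoef k l m n ^ 2 = ((k + l).choose k : ℝ) * ((m + n).choose m : ℝ) / (2 ^ (k + l) * 2 ^ (k + l)) := by
  unfold LLLcoef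
  rw [div_pow, mul_pow, Real.sq_sqrt (by positivity)]
  have h1 : ((k + l).choose k : ℝ) * k.factorial * l.factorial = (k + l).factorial := by
    rw [Nat.choose_symm_add]; exact_mod_cast Nat.add_choose_mul_factorial_mul_factorial k l
  have h2 : ((m + n).choose m : ℝ) * m.factorial * n.factorial = (k + l).factorial := by
    rw [h, Nat.choose_symm_add]; exact_mod_cast Nat.add_choose_mul_factorial_mul_factorial m n
  rw [div_eq_div_iff (by positivity) (by positivity)]
  rw [sq]
  nth_rewrite 1 [← h1]
  rw [← h2]
  ring

lemma LLLcoef_weight (p q : ℝ) (hp : 0 ≤ p) (hq : 0 ≤ q) (hpq : p ^ 2 + q ^ 2 ≤ 2) (k l m n : ℕ)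
    (h : k + l = m + n) : LLLcoef k l m n * (p ^ l * q ^ k) ≤ 1 := by
  have h0 := LLLcoef_nonneg k l m n
  rw [← pow_le_one_iff_of_nonneg (by positivity) (two_ne_zero), mul_pow, LLLcoef_sq k l m n h]
  have h1 := choose_weight p q hpq k l
  have h2 : ((m + n).choose m : ℝ) ≤ 2 ^ (k + l) := by
    rw [h]; exact_mod_cast Nat.choose_le_two_pow _ _
  rw [div_mul_eq_mul_div, div_le_one (by positivity)]
  calc _ = (((k + l).choose k : ℝ) * (q ^ 2) ^ k * (p ^ 2) ^ l) * ((m + n).choose m : ℝ) := by ring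
    _ ≤ _ := by gcongr

lemma LLLcoef_le_one (k l m n : ℕ) (h : k + l = m + n) : LLLcoef k l m n ≤ 1 := by
  have := LLLcoef_weight 1 1 (by norm_num) (by norm_num) (by norm_num) k l m n h
  simpa using this

lemma term_bound (c : ℕ → ℂ) (R σ θ C r : ℝ) (hR : 0 < R) (hσ : 0 < σ) (hθ : 0 < θ)
    (hst : 1 ≤ σ ^ 2 * θ ^ 2 * (2 - R ^ 2)) (hr : 0 < r) (hrR : r ≤ R) (hC : 0 ≤ C)
    (hb : ∀ k, ‖c k‖ ≤ C * r ^ k) (k : ℕ) (t : ℕ × ℕ × ℕ) :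
    ‖LLLterm c k t‖ ≤ C ^ 3 * (θ * r) ^ k * ((R / σ) ^ t.1 * (σ ^ t.2.1 * σ ^ t.2.2)) := by
  obtain ⟨l, m, n⟩ := t
  unfold LLLterm
  split_ifs with h
  · simp only at h ⊢
    rw [norm_mul, norm_mul, norm_mul, RCLike.norm_conj, Complex.norm_real, Real.norm_eq_abs,
      abs_of_nonneg (LLLcoef_nonneg _ _ _ _)]
    have hq : R ^ 2 + (1 / (σ * θ)) ^ 2 ≤ 2 := by
      have : (1 / (σ * θ)) ^ 2 ≤ 2 - R ^ 2 := by
        rw [div_pow, one_pow, div_le_iff₀ (by positivity)]; linarith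
      linarith
    have hw := LLLcoef_weight R (1 / (σ * θ)) hR.le (by positivity) hq k l m n h
    have hw' : LLLcoef k l m n ≤ (σ * θ) ^ k / R ^ l := by
      rw [le_div_iff₀ (by positivity)]
      rw [div_pow, one_pow, ← mul_assoc, mul_one_div, div_le_one (by positivity)] at hw
      exact hw
    have h0 := LLLcoef_nonneg k l m n
    calc LLLcoef k l m n * ‖c l‖ * ‖c m‖ * ‖c n‖
        ≤ ((σ * θ) ^ k / R ^ l) * (C * r ^ l) * (C * r ^ m) * (C * r ^ n) := by
          gcongr <;> apply hb
      _ = C ^ 3 * (σ * θ) ^ k / R ^ l * r ^ l * r ^ (m + n) := by ring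
      _ = C ^ 3 * (σ * θ) ^ k * r ^ k / R ^ l * (r ^ l * r ^ l) := by rw [← h]; ring
      _ ≤ C ^ 3 * (σ * θ) ^ k * r ^ k / R ^ l * (R ^ l * R ^ l) := by gcongr
      _ = C ^ 3 * (θ * r) ^ k * ((R / σ) ^ l * σ ^ (k + l)) := by
          rw [div_pow]; field_simp
          ring
      _ = _ := by rw [h, pow_add]
  · rw [norm_zero]; positivity

lemma nonlin_bound (c : ℕ → ℂ) (R σ θ C r : ℝ) (hR : 0 < R) (hRσ : R < σ) (hσ1 : σ < 1) (hθ : 0 < θ)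
    (hst : 1 ≤ σ ^ 2 * θ ^ 2 * (2 - R ^ 2)) (hr : 0 < r) (hrR : r ≤ R) (hC : 0 ≤ C)
    (hb : ∀ k, ‖c k‖ ≤ C * r ^ k) (k : ℕ) :
    ‖∑' t, LLLterm c k t‖ ≤
      C ^ 3 * (θ * r) ^ k * ((1 - R / σ)⁻¹ * ((1 - σ)⁻¹ * (1 - σ)⁻¹)) := by
  have hσ : 0 < σ := hR.trans hRσ
  refine tsum_of_norm_bounded ?_ (term_bound c R σ θ C r hR hσ hθ hst hr hrR hC hb k)
  apply HasSum.mul_left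
  have h1 : HasSum (fun n : ℕ => (R / σ) ^ n) (1 - R / σ)⁻¹ :=
    hasSum_geometric_of_lt_one (by positivity) ((div_lt_one hσ).2 hRσ)
  have h2 : HasSum (fun n : ℕ => σ ^ n) (1 - σ)⁻¹ := hasSum_geometric_of_lt_one hσ.le hσ1
  have h3 := h2.mul h2 (h2.summable.mul_of_nonneg h2.summable
    (fun n => by positivity) (fun n => by positivity))
  exact h1.mul h3 (h1.summable.mul_of_nonneg h3.summable
    (fun n => by positivity) (fun n => by dsimp; positivity))

lemma iter_bound (c : ℕ → ℂ) (lam mu δ : ℝ) (k0 : ℕ) (hδ : 0 < δ)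
    (hlow : ∀ k : ℕ, k0 ≤ k → δ ≤ |lam + mu * k|)
    (heq : ∀ k : ℕ, ((lam + mu * k : ℝ) : ℂ) * c k =
      ((1 / (2 * Real.pi) : ℝ) : ℂ) * ∑' t : ℕ × ℕ × ℕ, LLLterm c k t)
    (R σ θ B r : ℝ) (hR : 0 < R) (hRσ : R < σ) (hσ1 : σ < 1) (hθ : 0 < θ) (hθ1 : θ < 1)
    (hst : 1 ≤ σ ^ 2 * θ ^ 2 * (2 - R ^ 2)) (hr : 0 < r) (hrR : r ≤ R)
    (hb : ∀ k, ‖c k‖ ≤ B * r ^ k) :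
    ∃ M : ℝ, 1 ≤ M ∧ ∀ j k : ℕ, ‖c k‖ ≤ M ^ (2 * 3 ^ j) / M * (θ ^ j * r) ^ k := by
  have hσ : 0 < σ := hR.trans hRσ
  have hr1 : r < 1 := by linarith
  set K : ℝ := 1 / (2 * Real.pi) * ((1 - R / σ)⁻¹ * ((1 - σ)⁻¹ * (1 - σ)⁻¹)) / δ with hK
  obtain ⟨M, hM⟩ : ∃ M : ℝ, max (max 1 K) (max B (max ((θ ^ k0)⁻¹) ((r ^ k0)⁻¹))) ≤ M := ⟨_, le_rfl⟩
  simp only [max_le_iff] at hM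
  obtain ⟨⟨hM1, hMK⟩, hMB, hMθ, hMr⟩ := hM
  have hM0 : 0 < M := by linarith
  refine ⟨M, hM1, fun j => ?_⟩
  induction j with
  | zero =>
    intro k
    refine (hb k).trans ?_
    have : M ^ (2 * 3 ^ 0) / M = M := by field_simp; norm_num
    rw [this, pow_zero, one_mul]
    gcongr
  | succ j ih =>
    intro k
    have hρ : 0 < θ ^ j * r := by positivity
    have hρR : θ ^ j * r ≤ R :=
      (mul_le_of_le_one_left hr.le (pow_le_one₀ hθ.le hθ1.le)).trans hrR
    rcases lt_or_ge k k0 with hk | hk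
    · have hcB : ‖c k‖ ≤ M := by
        refine (hb k).trans ?_
        have hB : 0 ≤ B := by
          have := (norm_nonneg _).trans (hb 0)
          simpa using this
        exact (mul_le_of_le_one_right hB (pow_le_one₀ hr.le hr1.le)).trans hMB
      refine hcB.trans ?_
      have e1 : 1 ≤ M ^ (j + 2) * (θ ^ (j + 1) * r) ^ k := by
        have a1 : 1 ≤ M * θ ^ k := by
          have : 1 ≤ M * θ ^ k0 := by
            rwa [inv_le_iff_one_le_mul₀ (by positivity)] at hMθ
          refine this.trans ?_
          gcongr M * ?_
          exact pow_le_pow_of_le_one hθ.le hθ1.le hk.le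
        have a2 : 1 ≤ M * r ^ k := by
          have : 1 ≤ M * r ^ k0 := by
            rwa [inv_le_iff_one_le_mul₀ (by positivity)] at hMr
          refine this.trans ?_
          gcongr M * ?_
          exact pow_le_pow_of_le_one hr.le hr1.le hk.le
        have a3 : 1 ≤ (M * θ ^ k) ^ (j + 1) := one_le_pow₀ a1
        calc (1 : ℝ) ≤ (M * θ ^ k) ^ (j + 1) * (M * r ^ k) := one_le_mul_of_one_le_of_one_le a3 a2
          _ = _ := by
            rw [mul_pow, mul_pow, ← pow_mul, ← pow_mul, mul_comm k (j + 1)]; ring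
      have e2 : M * M ^ (j + 2) ≤ M ^ (2 * 3 ^ (j + 1)) / M := by
        rw [le_div_iff₀ hM0]
        have : M * M ^ (j + 2) * M = M ^ (j + 4) := by ring
        rw [this]
        apply pow_le_pow_right₀ hM1
        have := Nat.lt_pow_self (n := j) (a := 3) (by norm_num)
        rw [pow_succ]; omega
      calc M ≤ M * (M ^ (j + 2) * (θ ^ (j + 1) * r) ^ k) := le_mul_of_one_le_right hM0.le e1
        _ = M * M ^ (j + 2) * (θ ^ (j + 1) * r) ^ k := by ring
        _ ≤ _ := by gcongr
    · have hN := nonlin_bound c R σ θ _ _ hR hRσ hσ1 hθ hst hρ hρR (by positivity) ih k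
      have hE := congrArg norm (heq k)
      rw [norm_mul, norm_mul, Complex.norm_real, Complex.norm_real, Real.norm_eq_abs,
        Real.norm_eq_abs, abs_of_nonneg (by positivity : (0:ℝ) ≤ 1 / (2 * Real.pi))] at hE
      have h1 : δ * ‖c k‖ ≤ |lam + mu * k| * ‖c k‖ := by
        gcongr; exact hlow k hk
      rw [hE] at h1
      have h2 : ‖c k‖ ≤ K * ((M ^ (2 * 3 ^ j) / M) ^ 3 * (θ * (θ ^ j * r)) ^ k) := by
        rw [hK, div_mul_eq_mul_div, le_div_iff₀ hδ]
        calc ‖c k‖ * δ = δ * ‖c k‖ := mul_comm _ _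
          _ ≤ _ := h1
          _ ≤ 1 / (2 * Real.pi) * _ := mul_le_mul_of_nonneg_left hN (by positivity)
          _ = _ := by ring
      refine h2.trans ?_
      calc K * ((M ^ (2 * 3 ^ j) / M) ^ 3 * (θ * (θ ^ j * r)) ^ k)
          ≤ M ^ 2 * ((M ^ (2 * 3 ^ j) / M) ^ 3 * (θ * (θ ^ j * r)) ^ k) := by
            gcongr
            exact hMK.trans (le_self_pow₀ hM1 two_ne_zero)
        _ = M ^ (2 * 3 ^ (j + 1)) / M * (θ ^ (j + 1) * r) ^ k := by
            have e : M ^ (2 * 3 ^ (j + 1)) = (M ^ (2 * 3 ^ j)) ^ 3 := by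
              rw [← pow_mul]; congr 1; ring
            rw [e, div_pow, pow_succ θ j, mul_comm (θ ^ j) θ, mul_assoc]
            field_simp

lemma low_bound (lam mu : ℝ) (h : ¬ (lam = 0 ∧ mu = 0)) :
    ∃ (δ : ℝ) (k0 : ℕ), 0 < δ ∧ ∀ k : ℕ, k0 ≤ k → δ ≤ |lam + mu * k| := by
  by_cases hmu : mu = 0
  · have hl : lam ≠ 0 := fun hl => h ⟨hl, hmu⟩
    exact ⟨|lam|, 0, abs_pos.2 hl, fun k _ => by simp [hmu]⟩
  · have hm : 0 < |mu| := abs_pos.2 hmu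
    obtain ⟨k0, hk0⟩ := exists_nat_ge ((1 + |lam|) / |mu|)
    refine ⟨1, k0, one_pos, fun k hk => ?_⟩
    rw [div_le_iff₀ hm] at hk0
    have h1 : (k0 : ℝ) ≤ k := by exact_mod_cast hk
    have h2 : |mu * k| ≤ |lam + mu * k| + |lam| := by
      have := abs_sub (lam + mu * k) lam
      simpa using this
    rw [abs_mul, Nat.abs_cast] at h2
    nlinarith

lemma final_bound (a : ℕ → ℝ) (M r θ γ : ℝ) (hM : 1 ≤ M) (hr : 0 < r) (hr1 : r ≤ 1)
    (hθ : 0 < θ) (hθ1 : θ < 1) (hγ : γ * Real.log 3 < - Real.log θ)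
    (ha : ∀ j k : ℕ, a k ≤ M ^ (2 * 3 ^ j) / M * (θ ^ j * r) ^ k) :
    ∃ C : ℝ, 0 < C ∧ ∀ k : ℕ, 1 ≤ k → a k ≤ C * (k : ℝ) ^ (-(γ * k)) := by
  have hM0 : 0 < M := by linarith
  have hl3 : 0 < Real.log 3 := Real.log_pos (by norm_num)
  set g : ℝ := - Real.log θ / Real.log 3 with hg
  have hgγ : γ < g := by rw [hg, lt_div_iff₀ hl3]; exact hγ
  set N : ℝ := M ^ 2 / θ with hN
  have hN1 : 1 ≤ N := by
    rw [hN, le_div_iff₀ hθ]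
    have : 1 ≤ M ^ 2 := one_le_pow₀ hM
    linarith
  have hg0 : 0 < g := div_pos (neg_pos.2 (Real.log_neg hθ hθ1)) hl3
  have key : ∀ k : ℕ, 1 ≤ k → a k ≤ N ^ k * (k : ℝ) ^ (-(g * k)) := by
    intro k hk
    have hk0 : (0 : ℝ) < k := by exact_mod_cast hk
    set j := Nat.log 3 k with hj
    have h3 : 3 ^ j ≤ k := Nat.pow_log_le_self 3 (by omega)
    have h3' : k < 3 ^ (j + 1) := Nat.lt_pow_succ_log_self (by norm_num) k
    have hθj : θ ^ j ≤ θ⁻¹ * (k : ℝ) ^ (-g) := by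
      have e : θ ^ (j + 1) ≤ (k : ℝ) ^ (-g) := by
        have hlog : Real.log k ≤ (j + 1) * Real.log 3 := by
          have : (k : ℝ) ≤ 3 ^ (j + 1) := by exact_mod_cast h3'.le
          have := Real.log_le_log hk0 this
          rw [Real.log_pow] at this
          exact_mod_cast this
        rw [← Real.log_le_log_iff (by positivity) (by positivity), Real.log_pow,
          Real.log_rpow hk0]
        have hθg : Real.log θ = - g * Real.log 3 := by rw [hg]; field_simp
        rw [hθg]
        push_cast
        nlinarith
      rw [inv_mul_eq_div, le_div_iff₀ hθ, ← pow_succ]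
      exact e
    have hMk : M ^ (2 * 3 ^ j) / M ≤ (M ^ 2) ^ k := by
      rw [← pow_mul]
      exact (div_le_self (by positivity) hM).trans (pow_le_pow_right₀ hM (by omega))
    calc a k ≤ M ^ (2 * 3 ^ j) / M * (θ ^ j * r) ^ k := ha j k
      _ ≤ (M ^ 2) ^ k * (θ ^ j * 1) ^ k := by gcongr
      _ ≤ (M ^ 2) ^ k * (θ⁻¹ * (k : ℝ) ^ (-g)) ^ k := by rw [mul_one]; gcongr
      _ = _ := by
        rw [mul_pow, ← Real.rpow_mul_natCast hk0.le, hN, div_eq_mul_inv, mul_pow, neg_mul]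
        ring
  obtain ⟨k1, hk1⟩ : ∃ k1 : ℕ, ∀ k : ℕ, k1 ≤ k → N ≤ (k : ℝ) ^ (g - γ) := by
    have := ((tendsto_rpow_atTop (sub_pos.2 hgγ)).comp
      (tendsto_natCast_atTop_atTop (R := ℝ))).eventually_ge_atTop N
    exact Filter.eventually_atTop.1 this
  refine ⟨N ^ k1, by positivity, fun k hk => (key k hk).trans ?_⟩
  have hk0 : (0 : ℝ) < k := by exact_mod_cast hk
  have hk1' : (1 : ℝ) ≤ k := by exact_mod_cast hk
  have split : (k : ℝ) ^ (-(g * k)) = ((k : ℝ) ^ (g - γ))⁻¹ ^ k * (k : ℝ) ^ (-(γ * k)) := by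
    rw [← Real.rpow_neg hk0.le, ← Real.rpow_mul_natCast hk0.le, ← Real.rpow_add hk0]
    congr 1; ring
  rw [split, ← mul_assoc, ← mul_pow]
  gcongr ?_ * _
  have hpos : 0 < (k : ℝ) ^ (g - γ) := by positivity
  rcases le_or_gt k1 k with h | h
  · have : N * ((k : ℝ) ^ (g - γ))⁻¹ ≤ 1 := by
      rw [mul_inv_le_iff₀ hpos, one_mul]; exact hk1 k h
    exact (pow_le_one₀ (by positivity) this).trans (one_le_pow₀ hN1)
  · have : ((k : ℝ) ^ (g - γ))⁻¹ ≤ 1 :=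
      inv_le_one_of_one_le₀ (Real.one_le_rpow hk1' (sub_pos.2 hgγ).le)
    calc (N * ((k : ℝ) ^ (g - γ))⁻¹) ^ k ≤ (N * 1) ^ k := by gcongr
      _ = N ^ k := by rw [mul_one]
      _ ≤ N ^ k1 := pow_le_pow_right₀ hN1 h.le

lemma degenerate (r C₀ : ℝ) (hr0 : 0 < r) (hr1 : r < 1)
    (hC₀ : 0 < C₀) (c : ℕ → ℂ) (hb : ∀ k : ℕ, ‖c k‖ ≤ C₀ * r ^ k)
    (hz : ∀ k : ℕ, ∑' t : ℕ × ℕ × ℕ, LLLterm c k t = 0) : ∀ k, c k = 0 := by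
  let b : ℕ → ℂ := fun k => c k / ((Real.sqrt k.factorial : ℝ) : ℂ)
  let w : ℕ → ℝ := fun s => (s.factorial : ℝ) / 2 ^ s
  let B : ℕ × ℕ → ℂ := fun x => b x.1 * b x.2
  let P : ℕ → ℂ := fun s => ∑ y ∈ Finset.HasAntidiagonal.antidiagonal s, B y
  let F : ℕ × ℕ × ℕ × ℕ → ℂ := fun x => (starRingEnd ℂ) (c x.1) * LLLterm c x.1 x.2
  let G : (ℕ × ℕ) × (ℕ × ℕ) → ℂ := fun x =>
    if x.1.1 + x.1.2 = x.2.1 + x.2.2 then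
      (w (x.1.1 + x.1.2) : ℂ) * (starRingEnd ℂ) (B x.1) * B x.2 else 0
  have hFG : ∀ x, F ((Equiv.prodAssoc ℕ ℕ (ℕ × ℕ)) x) = G x := by
    rintro ⟨⟨k, l⟩, ⟨m, n⟩⟩
    simp only [F, G, LLLterm, Equiv.prodAssoc_apply, mul_ite, mul_zero]
    split_ifs with h
    · simp only [LLLcoef, w, B, b, map_mul, map_div₀, Complex.conj_ofReal]
      rw [Real.sqrt_mul (by positivity), Real.sqrt_mul (by positivity),
        Real.sqrt_mul (by positivity)]
      push_cast
      have hs : ∀ i : ℕ, ((Real.sqrt i.factorial : ℝ) : ℂ) ≠ 0 := fun i => by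
        rw [Complex.ofReal_ne_zero]; positivity
      have := hs k
      have := hs l
      have := hs m
      have := hs n
      field_simp
    · rfl
  have hFs : Summable F := by
    have g1 : Summable (fun n : ℕ => r ^ n) := summable_geometric_of_lt_one hr0.le hr1
    have g2 := g1.mul_of_nonneg g1 (fun n => by positivity) (fun n => by positivity)
    have g3 := g1.mul_of_nonneg g2 (fun n => by positivity) (fun n => by dsimp; positivity)
    have g4 := g1.mul_of_nonneg g3 (fun n => by positivity) (fun n => by dsimp; positivity)
    refine Summable.of_norm_bounded (g4.mul_left (C₀ ^ 4)) ?_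
    rintro ⟨k, l, m, n⟩
    simp only [F, LLLterm]
    split_ifs with h
    · rw [norm_mul, norm_mul, norm_mul, norm_mul, RCLike.norm_conj, RCLike.norm_conj,
        Complex.norm_real, Real.norm_eq_abs, abs_of_nonneg (LLLcoef_nonneg _ _ _ _)]
      have h1 := LLLcoef_le_one k l m n h
      have h0 := LLLcoef_nonneg k l m n
      calc _ ≤ (C₀ * r ^ k) * (1 * (C₀ * r ^ l) * (C₀ * r ^ m) * (C₀ * r ^ n)) := by
            gcongr <;> apply hb
        _ = _ := by ring
    · rw [mul_zero, norm_zero]; positivity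
  have hF0 : ∑' x, F x = 0 := by
    rw [hFs.tsum_prod]
    simp only [F, tsum_mul_left, hz, mul_zero, tsum_zero]
  have hGs : Summable G := by
    have := (Equiv.prodAssoc ℕ ℕ (ℕ × ℕ)).summable_iff.2 hFs
    exact this.congr (fun x => hFG x)
  have hG0 : ∑' x, G x = 0 := by
    rw [← hF0, ← (Equiv.prodAssoc ℕ ℕ (ℕ × ℕ)).tsum_eq F]
    exact tsum_congr (fun x => (hFG x).symm)
  have hinner : ∀ x : ℕ × ℕ, ∑' y, G (x, y) =
      (w (x.1 + x.2) : ℂ) * (starRingEnd ℂ) (B x) * P (x.1 + x.2) := by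
    intro x
    rw [tsum_eq_sum (s := Finset.HasAntidiagonal.antidiagonal (x.1 + x.2))]
    · simp only [P, Finset.mul_sum]
      refine Finset.sum_congr rfl fun y hy => ?_
      rw [Finset.HasAntidiagonal.mem_antidiagonal] at hy
      simp only [G]
      rw [if_pos hy.symm]
    · intro y hy
      rw [Finset.HasAntidiagonal.mem_antidiagonal] at hy
      simp only [G]
      rw [if_neg (fun h => hy h.symm)]
  let H : ℕ × ℕ → ℂ := fun x => (w (x.1 + x.2) : ℂ) * (starRingEnd ℂ) (B x) * P (x.1 + x.2)
  have hHs : Summable H := hGs.prod.congr (fun x => (hinner x))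
  have hH0 : ∑' x, H x = 0 := by
    rw [← hG0, hGs.tsum_prod]
    exact tsum_congr (fun x => (hinner x).symm)
  have hSs : Summable (H ∘ Finset.HasAntidiagonal.sigmaAntidiagonalEquivProd) :=
    Finset.HasAntidiagonal.sigmaAntidiagonalEquivProd.summable_iff.2 hHs
  have hfib : ∀ s : ℕ, ∑' x : Finset.HasAntidiagonal.antidiagonal s,
      (H ∘ Finset.HasAntidiagonal.sigmaAntidiagonalEquivProd) ⟨s, x⟩ = ((w s * ‖P s‖ ^ 2 : ℝ) : ℂ) := by
    intro s
    rw [tsum_fintype]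
    simp only [Function.comp, Finset.HasAntidiagonal.sigmaAntidiagonalEquivProd_apply]
    rw [Finset.sum_coe_sort (Finset.HasAntidiagonal.antidiagonal s) H]
    have : ∀ x ∈ Finset.HasAntidiagonal.antidiagonal s, H x = (w s : ℂ) * P s * (starRingEnd ℂ) (B x) := by
      intro x hx
      rw [Finset.HasAntidiagonal.mem_antidiagonal] at hx
      simp only [H, hx]; ring
    rw [Finset.sum_congr rfl this, ← Finset.mul_sum, ← map_sum]
    change (w s : ℂ) * P s * (starRingEnd ℂ) (P s) = _
    rw [mul_assoc, Complex.mul_conj, Complex.normSq_eq_norm_sq]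
    push_cast; rfl
  have hWs : Summable (fun s : ℕ => ((w s * ‖P s‖ ^ 2 : ℝ) : ℂ)) :=
    hSs.sigma.congr (fun s => (hfib s))
  have hW0 : ∑' s : ℕ, ((w s * ‖P s‖ ^ 2 : ℝ) : ℂ) = 0 := by
    rw [← hH0, ← Finset.HasAntidiagonal.sigmaAntidiagonalEquivProd.tsum_eq H]
    have := hSs.tsum_sigma
    simp only [Function.comp] at this
    rw [this]
    exact tsum_congr (fun s => (hfib s).symm)
  rw [Complex.summable_ofReal] at hWs
  rw [← Complex.ofReal_tsum, Complex.ofReal_eq_zero] at hW0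
  have hw : ∀ s, 0 < w s := fun s => by simp only [w]; positivity
  have hP : ∀ s, P s = 0 := by
    intro s
    have h1 := hWs.hasSum
    rw [hW0] at h1
    have h2 := (hasSum_zero_iff_of_nonneg (fun s => by have := hw s; positivity)).1 h1
    have h3 := congrFun h2 s
    simp only [Pi.zero_apply, mul_eq_zero, (hw s).ne', false_or] at h3
    simpa using h3
  have hps : PowerSeries.mk b * PowerSeries.mk b = 0 := by
    ext s
    rw [PowerSeries.coeff_mul]
    simp only [PowerSeries.coeff_mk, map_zero]
    exact hP s
  have hb0 : PowerSeries.mk b = 0 := mul_self_eq_zero.1 hps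
  intro k
  have hk : b k = 0 := by
    have := congrArg (PowerSeries.coeff k) hb0
    simpa using this
  simp only [b, div_eq_zero_iff] at hk
  rcases hk with hk | hk
  · exact hk
  · rw [Complex.ofReal_eq_zero] at hk
    exact absurd hk (by positivity)

lemma pick (f : ℝ → ℝ) (hf : Continuous f) (h1 : 1 < f 1) (y : ℝ) (hy : y < 1) :
    ∃ σ, y < σ ∧ σ < 1 ∧ 1 < f σ := by
  have e1 : ∀ᶠ x in nhdsWithin (1 : ℝ) (Set.Iio 1), 1 < f x :=
    (hf.continuousAt.eventually (lt_mem_nhds h1)).filter_mono nhdsWithin_le_nhds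
  have e2 : ∀ᶠ x in nhdsWithin (1 : ℝ) (Set.Iio 1), x ∈ Set.Ioo y 1 := Ioo_mem_nhdsLT hy
  obtain ⟨σ, h, h'⟩ := (e1.and e2).exists
  exact ⟨σ, h'.1, h'.2, h⟩

theorem stationary_coefficients_decay (lam mu r C₀ : ℝ) (hr0 : 0 < r) (hr1 : r < 1)
    (hC₀ : 0 < C₀) (c : ℕ → ℂ)
    (hb : ∀ k : ℕ, ‖c k‖ ≤ C₀ * r ^ k)
    (hsum : ∀ k : ℕ, Summable (fun t : ℕ × ℕ × ℕ => ‖LLLterm c k t‖))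
    (heq : ∀ k : ℕ, ((lam + mu * k : ℝ) : ℂ) * c k =
      ((1 / (2 * Real.pi) : ℝ) : ℂ) * ∑' t : ℕ × ℕ × ℕ, LLLterm c k t) :
    ∀ γ : ℝ, γ < (1 / 2) * (Real.log 2 / Real.log 3) →
      ∃ C : ℝ, 0 < C ∧ ∀ k : ℕ, 1 ≤ k → ‖c k‖ ≤ C * (k : ℝ) ^ (-(γ * k)) := by
  intro γ hγ
  by_cases hdeg : lam = 0 ∧ mu = 0
  · have hz : ∀ k : ℕ, ∑' t : ℕ × ℕ × ℕ, LLLterm c k t = 0 := by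
      intro k
      have h := heq k
      rw [hdeg.1, hdeg.2] at h
      simp only [zero_mul, add_zero, Complex.ofReal_zero] at h
      rcases mul_eq_zero.1 h.symm with h | h
      · rw [Complex.ofReal_eq_zero] at h
        exact absurd h (by positivity)
      · exact h
    have hc := degenerate r C₀ hr0 hr1 hC₀ c hb hz
    refine ⟨1, one_pos, fun k _ => ?_⟩
    rw [hc k, norm_zero]; positivity
  obtain ⟨δ, k0, hδ, hlow⟩ := low_bound lam mu hdeg
  have hl3 : 0 < Real.log 3 := Real.log_pos (by norm_num)
  have hl2 : 0 < Real.log 2 := Real.log_pos (by norm_num)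
  have hγ' : γ * Real.log 3 < Real.log 2 / 2 := by
    have : γ < (Real.log 2 / 2) / Real.log 3 := by
      calc γ < _ := hγ
        _ = _ := by ring
    rwa [lt_div_iff₀ hl3] at this
  obtain ⟨τ, hτ1, hτ2⟩ : ∃ τ, max (γ * Real.log 3) 0 < τ ∧ τ < Real.log 2 / 2 :=
    exists_between (max_lt hγ' (by positivity))
  obtain ⟨hτγ, hτ0⟩ := max_lt_iff.1 hτ1
  set θ : ℝ := Real.exp (-τ) with hθdef
  have hθ : 0 < θ := Real.exp_pos _
  have hθ1 : θ < 1 := by rw [hθdef, Real.exp_lt_one_iff]; linarith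
  have hθ2 : 1 < θ ^ 2 * 2 := by
    have : θ ^ 2 * 2 = Real.exp (Real.log 2 - 2 * τ) := by
      rw [sub_eq_add_neg, Real.exp_add, Real.exp_log (by norm_num), hθdef, ← Real.exp_nat_mul]
      push_cast
      rw [mul_comm]; congr 2; ring
    rw [this, Real.one_lt_exp_iff]; linarith
  -- second phase parameters
  obtain ⟨σ, hσ1, hσ2, hσ3⟩ := pick (fun σ => σ ^ 2 * θ ^ 2 * (2 - (1 - σ) ^ 2)) (by fun_prop)
    (by norm_num; linarith) (1 / 2) (by norm_num)
  -- first phase: reach a small radius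
  obtain ⟨η, hη1, hη2, hη3⟩ := pick (fun σ => σ ^ 2 * σ ^ 2 * (2 - r ^ 2)) (by fun_prop)
    (by norm_num; nlinarith) r hr1
  obtain ⟨M₁, hM₁, hfirst⟩ := iter_bound c lam mu δ k0 hδ hlow heq r η η C₀ r hr0 hη1 hη2
    (hr0.trans hη1) hη2 hη3.le hr0 le_rfl hb
  have hη0 : 0 < η := hr0.trans hη1
  obtain ⟨j, hj⟩ := exists_pow_lt_of_lt_one (sub_pos.2 hσ2) hη2
  have hj' : η ^ j * r ≤ 1 - σ := (mul_le_of_le_one_right (by positivity) hr1.le).trans hj.le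
  obtain ⟨M, hM, hsecond⟩ := iter_bound c lam mu δ k0 hδ hlow heq (1 - σ) σ θ _ (η ^ j * r)
    (by linarith) (by linarith) hσ2 hθ hθ1 hσ3.le (by positivity) hj' (hfirst j)
  exact final_bound (fun k => ‖c k‖) M (η ^ j * r) θ γ hM (by positivity) (by linarith) hθ hθ1
    (by rw [hθdef, Real.log_exp]; linarith) hsecond
end

section
/- Let λ, μ ∈ ℝ and let u : ℂ → ℂ be of the form u(z) = f(z) e^{−|z|²/2} with f entire, such that u is bounded on ℂ, u(z) → 0 as |z| → ∞, and for every z ∈ ℂ: λ u(z) + μ z f′(z) e^{−|z|²/2} = Π(|u|² u)(z). Then for every η > η₀ := (1/2 + (1/2)·(log 2/log 3))^{−1} there exists C > 0 such that |u(z)| ≤ C e^{|z|^η − |z|²/2} for all z ∈ ℂ. -/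
open MeasureTheory

/-- The lowest Landau level projector, given by the kernel
`K(z,w) = (1/π) e^{-|z|²/2 - |w|²/2 + w̄ z}`. -/
noncomputable def LLLProj (u : ℂ → ℂ) (z : ℂ) : ℂ :=
  (Real.pi : ℂ)⁻¹ * Complex.exp (-(‖z‖ : ℂ) ^ 2 / 2) *
    ∫ w : ℂ, Complex.exp ((starRingEnd ℂ) w * z - (‖w‖ : ℂ) ^ 2 / 2) * u w


lemma polar_avg (F : ℂ → ℂ) (hc : Continuous F) (hF : Integrable F) :
    ∫ w, F w = ∫ r in Set.Ioi (0:ℝ), (2 * Real.pi * r : ℝ) • Real.circleAverage F 0 r := by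
  have hpt : ∀ p : ℝ × ℝ, Complex.polarCoord.symm p = circleMap 0 p.1 p.2 := by
    intro p
    simp [circleMap, Complex.exp_mul_I]
  have hinteg : IntegrableOn (fun p : ℝ × ℝ => p.1 • F (Complex.polarCoord.symm p))
      (Set.Ioi (0:ℝ) ×ˢ Set.Ioo (-Real.pi) Real.pi) := by
    constructor
    · apply Continuous.aestronglyMeasurable
      simp only [Complex.polarCoord_symm_apply]
      fun_prop
    · have h1 := hF.2
      rw [hasFiniteIntegral_iff_enorm] at h1 ⊢
      rw [← Complex.lintegral_comp_polarCoord_symm] at h1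
      refine lt_of_le_of_lt ?_ h1
      apply le_of_eq
      apply setLIntegral_congr_fun (measurableSet_Ioi.prod measurableSet_Ioo)
      rintro p ⟨hp, -⟩
      simp only [enorm_smul, smul_eq_mul]
      congr 1
      exact Real.enorm_of_nonneg (le_of_lt hp)
  rw [← Complex.integral_comp_polarCoord_symm, polarCoord_target]
  rw [Measure.volume_eq_prod] at hinteg ⊢
  rw [setIntegral_prod _ hinteg]
  apply setIntegral_congr_fun measurableSet_Ioi
  intro r hr
  simp only [hpt]
  rw [integral_smul, Real.circleAverage]
  rw [← integral_Ioc_eq_integral_Ioo, ← intervalIntegral.integral_of_le (by linarith [Real.pi_pos])]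
  have hper : Function.Periodic (fun θ => F (circleMap 0 r θ)) (2 * Real.pi) := by
    intro θ; simp only [periodic_circleMap 0 r θ]
  have := hper.intervalIntegral_add_eq (-Real.pi) 0
  rw [show -Real.pi + 2 * Real.pi = Real.pi by ring, zero_add] at this
  rw [this, smul_smul]
  congr 1
  field_simp

lemma avg_shift (h : ℂ → ℂ) (hd : ∀ w, w ≠ 0 → DifferentiableAt ℂ h w) {r R : ℝ} (hr : 0 < r)
    (hR : r ≤ R) : Real.circleAverage h 0 r = Real.circleAverage h 0 R := by
  rw [Real.circleAverage_eq_circleIntegral hr.ne', Real.circleAverage_eq_circleIntegral (hr.trans_le hR).ne']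
  congr 1
  symm
  apply Complex.circleIntegral_sub_center_inv_smul_eq_of_differentiable_on_annulus_off_countable hr hR
    Set.countable_empty
  · intro w hw
    refine (hd w ?_).continuousAt.continuousWithinAt
    rintro rfl
    simp at hw; exact absurd hr (not_lt.2 hw.2)
  · intro w hw
    refine (hd w ?_)
    rintro rfl
    simp at hw; linarith [hw.2]

lemma avg_shift' (h : ℂ → ℂ) (hd : ∀ w, w ≠ 0 → DifferentiableAt ℂ h w) {r R : ℝ} (hr : 0 < r)
    (hR : 0 < R) : Real.circleAverage h 0 r = Real.circleAverage h 0 R := by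
  rcases le_total r R with h1 | h1
  · exact avg_shift h hd hr h1
  · exact (avg_shift h hd hR h1).symm

lemma norm_avg_le (h : ℂ → ℂ) {r : ℝ} (hr : 0 < r) {B : ℝ} (hB : ∀ w, ‖w‖ = r → ‖h w‖ ≤ B) :
    ‖Real.circleAverage h 0 r‖ ≤ B := by
  rw [Real.circleAverage, norm_smul]
  have : ‖∫ θ in (0:ℝ)..2 * Real.pi, h (circleMap 0 r θ)‖ ≤ B * |2 * Real.pi - 0| := by
    apply intervalIntegral.norm_integral_le_of_norm_le_const
    intro θ _
    apply hB
    simp [abs_of_pos hr]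
  rw [sub_zero, abs_of_pos Real.two_pi_pos] at this
  rw [norm_inv, Real.norm_of_nonneg Real.two_pi_pos.le, inv_mul_le_iff₀ Real.two_pi_pos]
  linarith

lemma gauss_int {c : ℝ} (hc : 0 < c) : Integrable (fun w : ℂ => Real.exp (-c * ‖w‖ ^ 2)) := by
  have h := (GaussianFourier.integrable_cexp_neg_mul_sq_norm_add (V := ℂ) (b := (c:ℂ))
    (by simpa using hc) 0 0).norm
  refine h.congr (Filter.Eventually.of_forall fun w => ?_)
  simp only [Complex.norm_exp]
  congr 1
  simp [← Complex.ofReal_pow]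

lemma cubic_bound {η : ℝ} (hη : 0 < η) : ∃ D : ℝ, 0 < D ∧ ∀ (f : ℂ → ℂ), Differentiable ℂ f →
    ∀ β C : ℝ, 0 < β → β < 1 → 0 ≤ C → β ^ 2 / 2 + η < 1 →
    (∀ w, ‖f w‖ ≤ C * Real.exp (β * ‖w‖ ^ 2 / 2)) → ∀ z : ℂ,
    ‖∫ w : ℂ, Complex.exp ((starRingEnd ℂ) w * z - 2 * (‖w‖ : ℂ) ^ 2) *
      (f w ^ 2 * (starRingEnd ℂ) (f w))‖ ≤
      D * C ^ 3 * Real.exp (β * ‖z‖ ^ 2 / (4 * (1 - β ^ 2 / 2 - η))) := by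
  have hri : IntegrableOn (fun r : ℝ => 2 * Real.pi * (r * Real.exp (-η * r ^ 2))) (Set.Ioi 0) :=
    ((integrable_mul_exp_neg_mul_sq hη).const_mul _).integrableOn
  have hD0 : 0 ≤ ∫ r in Set.Ioi (0:ℝ), 2 * Real.pi * (r * Real.exp (-η * r ^ 2)) := by
    apply setIntegral_nonneg measurableSet_Ioi
    intro r hr
    have : (0:ℝ) < r := hr
    positivity
  refine ⟨(∫ r in Set.Ioi (0:ℝ), 2 * Real.pi * (r * Real.exp (-η * r ^ 2))) + 1, by linarith, ?_⟩
  intro f hf β C hβ hβ1 hC hβη hb z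
  set Q := β * ‖z‖ ^ 2 / (4 * (1 - β ^ 2 / 2 - η)) with hQ
  set F : ℂ → ℂ := fun w => Complex.exp ((starRingEnd ℂ) w * z - 2 * (‖w‖ : ℂ) ^ 2) *
      (f w ^ 2 * (starRingEnd ℂ) (f w)) with hFdef
  have hfc := hf.continuous
  have hFc : Continuous F := by fun_prop
  have hre : ∀ w : ℂ, ((starRingEnd ℂ) w * z - 2 * (‖w‖ : ℂ) ^ 2).re ≤ ‖w‖ * ‖z‖ - 2 * ‖w‖ ^ 2 := by
    intro w
    rw [Complex.sub_re]
    have h1 : ((starRingEnd ℂ) w * z).re ≤ ‖w‖ * ‖z‖ := by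
      refine (Complex.re_le_norm _).trans ?_
      simp
    have h2 : (2 * (‖w‖ : ℂ) ^ 2).re = 2 * ‖w‖ ^ 2 := by
      rw [show (2 * (‖w‖ : ℂ) ^ 2) = ((2 * ‖w‖ ^ 2 : ℝ) : ℂ) by push_cast; ring, Complex.ofReal_re]
    linarith
  have hFi : Integrable F := by
    refine Integrable.mono' (((gauss_int (c := 1/4) (by norm_num)).const_mul
      (C ^ 3 * Real.exp (‖z‖ ^ 2)))) hFc.aestronglyMeasurable (Filter.Eventually.of_forall fun w => ?_)
    simp only [hFdef, norm_mul, norm_pow, Complex.norm_exp, RCLike.norm_conj]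
    calc _ ≤ Real.exp (‖w‖ * ‖z‖ - 2 * ‖w‖ ^ 2) * ((C * Real.exp (β * ‖w‖ ^ 2 / 2)) ^ 2 *
          (C * Real.exp (β * ‖w‖ ^ 2 / 2))) := by
          gcongr
          · exact hre w
          · exact hb w
          · exact hb w
      _ = C ^ 3 * Real.exp (‖w‖ * ‖z‖ - 2 * ‖w‖ ^ 2 + 3 * (β * ‖w‖ ^ 2 / 2)) := by
          rw [Real.exp_add, show 3 * (β * ‖w‖ ^ 2 / 2) = (β * ‖w‖ ^ 2 / 2) + (β * ‖w‖ ^ 2 / 2) +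
            (β * ‖w‖ ^ 2 / 2) by ring, Real.exp_add, Real.exp_add]; ring
      _ ≤ C ^ 3 * Real.exp (‖z‖ ^ 2 + (-(1/4) * ‖w‖ ^ 2)) := by
          refine mul_le_mul_of_nonneg_left (Real.exp_le_exp.2 ?_) (by positivity)
          nlinarith [sq_nonneg (‖w‖ / 2 - ‖z‖), mul_nonneg (sub_nonneg.2 hβ1.le) (sq_nonneg ‖w‖)]
      _ = _ := by rw [Real.exp_add]; ring
  rw [polar_avg F hFc hFi]
  have hkey : ∀ r : ℝ, 0 < r → ‖Real.circleAverage F 0 r‖ ≤ C ^ 3 * Real.exp Q * Real.exp (-η * r ^ 2) := by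
    intro r hr
    set h : ℂ → ℂ := fun w => Complex.exp ((r:ℂ) ^ 2 / w * z) *
      (f w ^ 2 * (starRingEnd ℂ) (f ((starRingEnd ℂ) ((r:ℂ) ^ 2 / w)))) * Complex.exp (-2 * (r:ℂ) ^ 2) with hh
    have h1 : Real.circleAverage F 0 r = Real.circleAverage h 0 r := by
      apply Real.circleAverage_congr_sphere
      intro w hw
      have hw' : ‖w‖ = r := by simpa [abs_of_pos hr] using hw
      have hw0 : w ≠ 0 := by rintro rfl; simp at hw'; exact hr.ne hw'
      have hcw : (r:ℂ) ^ 2 / w = (starRingEnd ℂ) w := by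
        rw [div_eq_iff hw0, ← hw', ← Complex.ofReal_pow, ← Complex.normSq_eq_norm_sq, mul_comm,
          Complex.mul_conj]
      simp only [hFdef, hh, hcw, hw', Complex.conj_conj]
      rw [sub_eq_add_neg, Complex.exp_add]
      ring_nf
    have hd : ∀ w, w ≠ 0 → DifferentiableAt ℂ h w := by
      intro w hw
      have hi : DifferentiableAt ℂ (fun w : ℂ => (r:ℂ) ^ 2 / w) w := by
        fun_prop (disch := assumption)
      have hs : Differentiable ℂ (fun w => (starRingEnd ℂ) (f ((starRingEnd ℂ) w))) := by
        intro w
        exact differentiableAt_conj_conj_iff.mpr (hf _)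
      have h3 : DifferentiableAt ℂ (fun w => (starRingEnd ℂ) (f ((starRingEnd ℂ) ((r:ℂ) ^ 2 / w)))) w :=
        (hs ((r:ℂ)^2 / w)).comp w hi
      have := hf w
      simp only [hh]
      fun_prop
    have hsb : 0 < Real.sqrt β := Real.sqrt_pos.2 hβ
    have hsb2 : Real.sqrt β ^ 2 = β := Real.sq_sqrt hβ.le
    have hR : 0 < r / Real.sqrt β := by positivity
    rw [h1, avg_shift' h hd hr hR]
    apply norm_avg_le _ hR
    intro w hw
    have hn1 : ‖(r:ℂ) ^ 2 / w‖ = r * Real.sqrt β := by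
      rw [norm_div, hw]
      simp only [norm_pow, Complex.norm_real, Real.norm_of_nonneg hr.le]
      field_simp
    have hw2 : ‖w‖ ^ 2 = r ^ 2 / β := by rw [hw, div_pow, hsb2]
    have e1 : ((r:ℂ) ^ 2 / w * z).re ≤ r * Real.sqrt β * ‖z‖ := by
      refine (Complex.re_le_norm _).trans ?_
      rw [norm_mul, hn1]
    have e2 : (-2 * (r:ℂ) ^ 2).re = - 2 * r ^ 2 := by
      rw [show (-2 * (r : ℂ) ^ 2) = ((-2 * r ^ 2 : ℝ) : ℂ) by push_cast; ring, Complex.ofReal_re]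
    have e3 : ‖f w‖ ≤ C * Real.exp (r ^ 2 / 2) := by
      have := hb w
      rwa [hw2, show β * (r ^ 2 / β) / 2 = r ^ 2 / 2 by field_simp] at this
    have e4 : ‖f ((starRingEnd ℂ) ((r:ℂ) ^ 2 / w))‖ ≤ C * Real.exp (β ^ 2 * r ^ 2 / 2) := by
      have := hb ((starRingEnd ℂ) ((r:ℂ) ^ 2 / w))
      rw [RCLike.norm_conj, hn1, mul_pow, hsb2] at this
      convert this using 3
      ring
    simp only [hh, norm_mul, norm_pow, Complex.norm_exp, RCLike.norm_conj, e2]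
    calc _ ≤ Real.exp (r * Real.sqrt β * ‖z‖) * ((C * Real.exp (r ^ 2 / 2)) ^ 2 *
          (C * Real.exp (β ^ 2 * r ^ 2 / 2))) * Real.exp (-2 * r ^ 2) := by
          gcongr
      _ = C ^ 3 * Real.exp (r * Real.sqrt β * ‖z‖ + r ^ 2 / 2 + r ^ 2 / 2 + β ^ 2 * r ^ 2 / 2 + -2 * r ^ 2) := by
          simp only [Real.exp_add]; ring
      _ ≤ C ^ 3 * Real.exp (Q + -η * r ^ 2) := by
          refine mul_le_mul_of_nonneg_left (Real.exp_le_exp.2 ?_) (by positivity)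
          have hc : 0 < 1 - β ^ 2 / 2 - η := by linarith
          set c := 1 - β ^ 2 / 2 - η with hcdef
          have : r * Real.sqrt β * ‖z‖ ≤ c * r ^ 2 + Q := by
            have h4 : c * r ^ 2 + Q - r * Real.sqrt β * ‖z‖ =
              (2 * c * r - Real.sqrt β * ‖z‖) ^ 2 / (4 * c) := by
              rw [hQ]
              nth_rewrite 1 [← hsb2]
              field_simp
              ring
            have : 0 ≤ (2 * c * r - Real.sqrt β * ‖z‖) ^ 2 / (4 * c) := by positivity
            linarith
          have h5 : c * r ^ 2 = r ^ 2 - β ^ 2 * r ^ 2 / 2 - η * r ^ 2 := by rw [hcdef]; ring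
          linarith
      _ = _ := by rw [Real.exp_add]; ring
  calc _ ≤ ∫ r in Set.Ioi (0:ℝ), (C ^ 3 * Real.exp Q) * (2 * Real.pi * (r * Real.exp (-η * r ^ 2))) := by
        apply norm_integral_le_of_norm_le (hri.const_mul _)
        refine (ae_restrict_iff' measurableSet_Ioi).2 (Filter.Eventually.of_forall fun r hr => ?_)
        have hr' : (0:ℝ) < r := hr
        rw [norm_smul, Real.norm_of_nonneg (by positivity)]
        calc _ ≤ 2 * Real.pi * r * (C ^ 3 * Real.exp Q * Real.exp (-η * r ^ 2)) := by
              gcongr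
              exact hkey r hr'
          _ = _ := by ring
    _ = (∫ r in Set.Ioi (0:ℝ), 2 * Real.pi * (r * Real.exp (-η * r ^ 2))) * C ^ 3 * Real.exp Q := by
        rw [integral_const_mul]; ring
    _ ≤ _ := by
        gcongr
        linarith

lemma inversion (lam mu : ℝ) (hlm : lam ≠ 0 ∨ mu ≠ 0) (f : ℂ → ℂ) (hf : Differentiable ℂ f) :
    ∃ A B N : ℝ, 0 < A ∧ 0 ≤ B ∧ 0 ≤ N ∧ ∀ (z : ℂ) (G : ℝ),
      (∀ z' : ℂ, ‖z'‖ = ‖z‖ → ‖(lam : ℂ) * f z' + (mu : ℂ) * (z' * deriv f z')‖ ≤ G) →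
      ‖f z‖ ≤ A * G + B * Real.exp (N * ‖z‖) := by
  by_cases hmu : mu = 0
  · have hlam : lam ≠ 0 := by tauto
    refine ⟨|lam|⁻¹, 0, 0, by positivity, le_rfl, le_rfl, fun z G hG => ?_⟩
    have := hG z rfl
    simp only [hmu, Complex.ofReal_zero, zero_mul, add_zero, norm_mul, Complex.norm_real,
      Real.norm_eq_abs] at this ⊢
    rw [le_inv_mul_iff₀ (by positivity)]
    exact this
  set κ : ℝ := lam / mu with hκ
  have hvar : ∀ (z : ℂ) (G : ℝ),
      (∀ z' : ℂ, ‖z'‖ = ‖z‖ → ‖(lam : ℂ) * f z' + (mu : ℂ) * (z' * deriv f z')‖ ≤ G) → ∀ θ : ℝ,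
      ‖f (z * Complex.exp (θ * Complex.I)) * Complex.exp (κ * θ * Complex.I) - f z‖ ≤ G / |mu| * |θ| := by
    intro z G hG θ
    set ψ : ℝ → ℂ := fun θ => f (z * Complex.exp (θ * Complex.I)) * Complex.exp (κ * θ * Complex.I)
      with hψ
    have hder : ∀ t : ℝ, HasDerivAt ψ ((Complex.I / mu) * Complex.exp (κ * t * Complex.I) *
        ((lam : ℂ) * f (z * Complex.exp (t * Complex.I)) + (mu : ℂ) * ((z * Complex.exp (t * Complex.I)) *
          deriv f (z * Complex.exp (t * Complex.I))))) t := by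
      intro t
      have h0 : HasDerivAt (fun s : ℝ => (s : ℂ)) 1 t := Complex.ofRealCLM.hasDerivAt
      have h1 : HasDerivAt (fun s : ℝ => z * Complex.exp (s * Complex.I))
          (z * (Complex.exp (t * Complex.I) * (1 * Complex.I))) t :=
        ((h0.mul_const Complex.I).cexp).const_mul z
      have h2 : HasDerivAt (fun s : ℝ => f (z * Complex.exp (s * Complex.I)))
          (deriv f (z * Complex.exp (t * Complex.I)) * (z * (Complex.exp (t * Complex.I) * (1 * Complex.I)))) t :=
        HasDerivAt.comp t (hf _).hasDerivAt h1
      have h3 : HasDerivAt (fun s : ℝ => Complex.exp (κ * s * Complex.I))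
          (Complex.exp (κ * t * Complex.I) * (κ * 1 * Complex.I)) t :=
        ((h0.const_mul (κ : ℂ)).mul_const Complex.I).cexp
      refine HasDerivAt.congr_deriv (f := ψ) (h2.mul h3) ?_
      have hm : (mu : ℂ) ≠ 0 := by exact_mod_cast hmu
      rw [hκ]
      push_cast
      field_simp
      ring
    have := Convex.norm_image_sub_le_of_norm_hasDerivWithin_le (f := ψ) (C := G / |mu|) (s := Set.univ)
      (x := 0) (y := θ) (fun x _ => (hder x).hasDerivWithinAt) ?_ convex_univ trivial trivial
    · simpa [hψ] using this
    · intro t _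
      have hn := hG (z * Complex.exp (t * Complex.I)) (by simp [Complex.norm_exp_ofReal_mul_I])
      rw [norm_mul, norm_mul, norm_div, Complex.norm_I, Complex.norm_real, Real.norm_eq_abs,
        ← Complex.ofReal_mul, Complex.norm_exp_ofReal_mul_I]
      calc _ ≤ 1 / |mu| * 1 * G := by gcongr
        _ = _ := by ring
  by_cases hE : Complex.exp (κ * (2 * Real.pi : ℝ) * Complex.I) = 1
  · obtain ⟨n, hn⟩ := Complex.exp_eq_one_iff.1 hE
    have hκn : (κ : ℂ) = n := by
      have h2 : (2 * Real.pi * Complex.I : ℂ) ≠ 0 := by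
        simp [Real.pi_ne_zero]
      apply mul_right_cancel₀ h2
      rw [← hn]; push_cast; ring
    obtain ⟨M, hM⟩ := (isCompact_closedBall (0:ℂ) 1).exists_bound_of_continuousOn hf.continuous.continuousOn
    have hM0 : 0 ≤ M := (norm_nonneg _).trans (hM 0 (by simp))
    refine ⟨Real.pi / |mu|, M, |(n:ℝ)|, by positivity, hM0, by positivity, fun z G hG => ?_⟩
    have hG0 : 0 ≤ G := (norm_nonneg _).trans (hG z rfl)
    have hAG : 0 ≤ Real.pi / |mu| * G := by positivity
    rcases le_total ‖z‖ 1 with hz | hz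
    · have h1 := hM z (by simpa using hz)
      have h2 : 1 ≤ Real.exp (|(n:ℝ)| * ‖z‖) := Real.one_le_exp (by positivity)
      nlinarith
    · set r := ‖z‖ with hr
      have hr0 : 0 < r := by linarith
      have hrc : (r : ℂ) ≠ 0 := by exact_mod_cast hr0.ne'
      set h : ℂ → ℂ := fun w => f (z / r * w) * w ^ n with hh
      have hd : ∀ w, w ≠ 0 → DifferentiableAt ℂ h w := by
        intro w hw
        have h1 : DifferentiableAt ℂ (fun w : ℂ => w ^ n) w := differentiableAt_zpow.2 (Or.inl hw)
        have h2 : DifferentiableAt ℂ (fun w : ℂ => f (z / r * w)) w :=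
          (hf _).comp w (differentiableAt_id.const_mul _)
        exact h2.mul h1
      have hci : CircleIntegrable h 0 r := by
        apply ContinuousOn.circleIntegrable hr0.le
        intro w hw
        refine (hd w ?_).continuousAt.continuousWithinAt
        rintro rfl
        simp at hw; linarith
      have h1 : ‖Real.circleAverage h 0 r‖ ≤ M := by
        rw [avg_shift' h hd hr0 one_pos]
        apply norm_avg_le _ one_pos
        intro w hw
        simp only [hh, norm_mul, norm_zpow, hw, one_zpow, mul_one]
        apply hM
        simp [hw, ← hr, abs_of_pos hr0, hr0.ne']
      have h2 : ‖Real.circleAverage (fun w => h w - (r:ℂ) ^ n * f z) 0 r‖ ≤ r ^ n * (Real.pi / |mu| * G) := by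
        apply norm_avg_le _ hr0
        intro w hw
        have hwa : w = r * Complex.exp (w.arg * Complex.I) := by
          rw [← hw]; exact (Complex.norm_mul_exp_arg_mul_I w).symm
        have hv := hvar z G hG w.arg
        have : h w - (r:ℂ) ^ n * f z = r ^ n * (f (z * Complex.exp (w.arg * Complex.I)) *
          Complex.exp (κ * w.arg * Complex.I) - f z) := by
          simp only [hh]
          rw [show z / r * w = z * Complex.exp (w.arg * Complex.I) by
            conv_lhs => rw [hwa]
            field_simp]
          have : w ^ n = r ^ n * Complex.exp (κ * w.arg * Complex.I) := by
            conv_lhs => rw [hwa]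
            rw [mul_zpow, ← Complex.exp_int_mul, hκn]
            ring_nf
          rw [this]; ring
        rw [this, norm_mul, norm_zpow, Complex.norm_real, Real.norm_of_nonneg hr0.le]
        gcongr
        refine hv.trans ?_
        calc G / |mu| * |w.arg| ≤ G / |mu| * Real.pi := by
              gcongr
              exact Complex.abs_arg_le_pi w
          _ = _ := by ring
      rw [Real.circleAverage_fun_sub hci (circleIntegrable_const _ _ _), Real.circleAverage_const] at h2
      have h3 : r ^ n * ‖f z‖ ≤ r ^ n * (Real.pi / |mu| * G) + M := by
        have h4 : ‖(r:ℂ) ^ n * f z‖ ≤ ‖Real.circleAverage h 0 r - (r:ℂ) ^ n * f z‖ + ‖Real.circleAverage h 0 r‖ := by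
          rw [norm_sub_rev]
          have := norm_add_le ((r:ℂ) ^ n * f z - Real.circleAverage h 0 r) (Real.circleAverage h 0 r)
          simpa using this
        rw [norm_mul, norm_zpow, Complex.norm_real, Real.norm_of_nonneg hr0.le] at h4
        linarith
      have hrn : 0 < r ^ n := zpow_pos hr0 n
      have h5 : 1 ≤ Real.exp (|(n:ℝ)| * r) * r ^ n := by
        rw [← Real.rpow_intCast, Real.rpow_def_of_pos hr0, ← Real.exp_add]
        apply Real.one_le_exp
        have hl0 : 0 ≤ Real.log r := Real.log_nonneg hz
        have hl1 : Real.log r ≤ r := (Real.log_le_sub_one_of_pos hr0).trans (by linarith)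
        have := neg_abs_le (n:ℝ)
        nlinarith [abs_nonneg (n:ℝ)]
      have h6 : r ^ n * ‖f z‖ ≤ r ^ n * (Real.pi / |mu| * G + M * Real.exp (|(n:ℝ)| * r)) := by
        nlinarith
      exact le_of_mul_le_mul_left h6 hrn
  · have hE' : 0 < ‖Complex.exp (κ * (2 * Real.pi : ℝ) * Complex.I) - 1‖ := norm_pos_iff.2 (sub_ne_zero.2 hE)
    refine ⟨2 * Real.pi / |mu| / ‖Complex.exp (κ * (2 * Real.pi : ℝ) * Complex.I) - 1‖, 0, 0,
      by positivity, le_rfl, le_rfl, fun z G hG => ?_⟩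
    have h1 := hvar z G hG (2 * Real.pi)
    rw [show Complex.exp (((2 * Real.pi : ℝ) : ℂ) * Complex.I) = 1 by
      push_cast; exact Complex.exp_two_pi_mul_I, mul_one,
      show f z * Complex.exp (κ * (2 * Real.pi : ℝ) * Complex.I) - f z = f z *
        (Complex.exp (κ * (2 * Real.pi : ℝ) * Complex.I) - 1) by ring, norm_mul,
      abs_of_pos Real.two_pi_pos, ← le_div_iff₀ hE'] at h1
    rw [zero_mul, add_zero]
    refine h1.trans (le_of_eq ?_)
    ring

set_option maxHeartbeats 1600000 in
lemma start_bound (f g u : ℂ → ℂ) (huc : Continuous u) (A B N M : ℝ) (hA : 0 < A) (hB : 0 ≤ B)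
    (hM : ∀ z, ‖u z‖ ≤ M)
    (hdecay : Filter.Tendsto u (Filter.cocompact ℂ) (nhds 0))
    (hfu : ∀ z, ‖f z‖ = ‖u z‖ * Real.exp (‖z‖ ^ 2 / 2))
    (hinv : ∀ (z : ℂ) (G : ℝ), (∀ z' : ℂ, ‖z'‖ = ‖z‖ → ‖g z'‖ ≤ G) →
      ‖f z‖ ≤ A * G + B * Real.exp (N * ‖z‖))
    (hg : ∀ z, ‖g z‖ ≤ Real.pi⁻¹ * Real.exp (‖z‖ ^ 2 / 2) *
      ∫ y : ℂ, Real.exp (-(1/2) * ‖z - y‖ ^ 2) * ‖u y‖ ^ 3) :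
    ∃ β C : ℝ, 0 < β ∧ β < 1 ∧ 0 ≤ C ∧ ∀ z, ‖f z‖ ≤ C * Real.exp (β * ‖z‖ ^ 2 / 2) := by
  have hM0 : 0 ≤ M := (norm_nonneg _).trans (hM 0)
  set I0 := ∫ s : ℂ, Real.exp (-(1/4) * ‖s‖ ^ 2) with hI0
  have hI0n : 0 ≤ I0 := integral_nonneg fun s => (Real.exp_pos _).le
  set A1 := A * (Real.pi⁻¹ * I0) with hA1
  have hpi := Real.pi_pos
  have hA1n : 0 ≤ A1 := by positivity
  set K' := A1 * (Real.exp 1 * M ^ 3) + B * Real.exp (N ^ 2) with hK'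
  have hK'n : 0 ≤ K' := by positivity
  set K := K' + M + 1 with hK
  have hKp : 0 < K := by positivity
  set ε := 1 / (16 * (A1 + 1) * K) with hε
  have hεp : 0 < ε := by positivity
  have hεK : A1 * (ε * (4 * K) ^ 2) ≤ K := by
    have : A1 * (ε * (4 * K) ^ 2) = K * (A1 / (A1 + 1)) := by
      rw [hε]; field_simp; ring
    rw [this]
    have h1 : A1 / (A1 + 1) ≤ 1 := by
      rw [div_le_one (by positivity)]; linarith
    nlinarith
  obtain ⟨R, hR0, hR⟩ : ∃ R : ℝ, 1 ≤ R ∧ ∀ y : ℂ, R ≤ ‖y‖ → ‖u y‖ ≤ ε := by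
    have h1 : ∀ᶠ y in Filter.cocompact ℂ, ‖u y‖ < ε := by
      have := (tendsto_zero_iff_norm_tendsto_zero.1 hdecay).eventually (gt_mem_nhds hεp)
      exact this
    rw [← Metric.cobounded_eq_cocompact, ← comap_norm_atTop] at h1
    obtain ⟨R, hR⟩ := Filter.eventually_atTop.1 (Filter.eventually_comap.1 h1)
    exact ⟨max R 1, le_max_right _ _, fun y hy => (hR ‖y‖ ((le_max_left _ _).trans hy) y rfl).le⟩
  set a := 1 / (8 * R ^ 2) with ha
  have hap : 0 < a := by positivity
  have haR : a * R ^ 2 = 1 / 8 := by rw [ha]; field_simp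
  have ha8 : a ≤ 1 / 8 := by
    have : 1 ≤ R ^ 2 := one_le_pow₀ hR0
    nlinarith
  set W : ℝ → ℝ → ℝ := fun T r => min (Real.exp (a * r ^ 2)) T with hW
  have hW2 : ∀ T : ℝ, 1 ≤ T → ∀ z y : ℂ, W T ‖z‖ ≤ Real.exp (2 * a * ‖z - y‖ ^ 2) * W T ‖y‖ ^ 2 := by
    intro T hT z y
    simp only [hW]
    have htri : ‖z‖ ≤ ‖z - y‖ + ‖y‖ := by simpa using norm_add_le (z - y) y
    rcases le_total (Real.exp (a * ‖y‖ ^ 2)) T with h | h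
    · rw [min_eq_left h, ← Real.exp_nat_mul, ← Real.exp_add]
      refine (min_le_left _ _).trans (Real.exp_le_exp.2 ?_)
      have : ‖z‖ ^ 2 ≤ 2 * ‖z - y‖ ^ 2 + 2 * ‖y‖ ^ 2 := by
        have := norm_nonneg z
        nlinarith [sq_nonneg (‖z - y‖ - ‖y‖)]
      push_cast
      nlinarith
    · rw [min_eq_right h]
      refine (min_le_right _ _).trans ?_
      have h1 : 1 ≤ Real.exp (2 * a * ‖z - y‖ ^ 2) := Real.one_le_exp (by positivity)
      nlinarith
  have hWpos : ∀ T : ℝ, 1 ≤ T → ∀ r, 0 < W T r := by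
    intro T hT r
    exact lt_min (Real.exp_pos _) (by linarith)
  have hstep : ∀ T S : ℝ, 1 ≤ T → (∀ z, W T ‖z‖ * ‖u z‖ ≤ S) →
      ∀ z, W T ‖z‖ * ‖u z‖ ≤ A1 * (ε * S ^ 2) + K' := by
    intro T S hT hS z
    have hS0 : 0 ≤ S := (mul_nonneg (hWpos T hT _).le (norm_nonneg _)).trans (hS 0)
    have hwp := hWpos T hT ‖z‖
    set L := ε * S ^ 2 + Real.exp 1 * M ^ 3 with hL
    have hLn : 0 ≤ L := by positivity
    have hpt : ∀ y : ℂ, W T ‖y‖ ^ 2 * ‖u y‖ ^ 3 ≤ L := by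
      intro y
      have hw0 := (hWpos T hT ‖y‖).le
      rcases le_total R ‖y‖ with h | h
      · have h1 : W T ‖y‖ ^ 2 * ‖u y‖ ^ 3 = ‖u y‖ * (W T ‖y‖ * ‖u y‖) ^ 2 := by ring
        have h2 : ‖u y‖ * (W T ‖y‖ * ‖u y‖) ^ 2 ≤ ε * S ^ 2 := by
          gcongr
          · exact hR y h
          · exact hS y
        have : 0 ≤ Real.exp 1 * M ^ 3 := by positivity
        linarith
      · have h1 : W T ‖y‖ ≤ Real.exp (1/8) := by
          refine (min_le_left _ _).trans (Real.exp_le_exp.2 ?_)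
          rw [← haR]
          gcongr
        have h2 : W T ‖y‖ ^ 2 * ‖u y‖ ^ 3 ≤ Real.exp (1/8) ^ 2 * M ^ 3 := by
          gcongr
          exact hM y
        have h3 : Real.exp (1/8) ^ 2 ≤ Real.exp 1 := by
          rw [← Real.exp_nat_mul]
          apply Real.exp_le_exp.2
          norm_num
        have h4 : Real.exp (1/8) ^ 2 * M ^ 3 ≤ Real.exp 1 * M ^ 3 := by gcongr
        have : 0 ≤ ε * S ^ 2 := by positivity
        linarith
    have hgi : ∀ z' : ℂ, ‖z'‖ = ‖z‖ → ‖g z'‖ ≤ Real.pi⁻¹ * Real.exp (‖z‖ ^ 2 / 2) * (I0 * L / W T ‖z‖) := by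
      intro z' hz'
      refine (hg z').trans ?_
      rw [hz']
      gcongr
      rw [le_div_iff₀ hwp, mul_comm _ (W T ‖z‖), ← integral_const_mul]
      have hinteg : Integrable (fun y : ℂ => Real.exp (-(1/4) * ‖z' - y‖ ^ 2)) :=
        (gauss_int (c := 1/4) (by norm_num)).comp_sub_left z'
      have hval : ∫ y : ℂ, Real.exp (-(1/4) * ‖z' - y‖ ^ 2) = I0 :=
        integral_sub_left_eq_self (fun s : ℂ => Real.exp (-(1/4) * ‖s‖ ^ 2)) volume z'
      rw [← hval, ← integral_mul_const]
      refine integral_mono_of_nonneg (Filter.Eventually.of_forall fun y => by positivity)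
        (hinteg.mul_const L) (Filter.Eventually.of_forall fun y => ?_)
      have h1 := hW2 T hT z' y
      rw [hz'] at h1
      calc W T ‖z‖ * (Real.exp (-(1/2) * ‖z' - y‖ ^ 2) * ‖u y‖ ^ 3)
          ≤ (Real.exp (2 * a * ‖z' - y‖ ^ 2) * W T ‖y‖ ^ 2) *
            (Real.exp (-(1/2) * ‖z' - y‖ ^ 2) * ‖u y‖ ^ 3) := by gcongr
        _ = Real.exp (2 * a * ‖z' - y‖ ^ 2 + -(1/2) * ‖z' - y‖ ^ 2) * (W T ‖y‖ ^ 2 * ‖u y‖ ^ 3) := by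
            rw [Real.exp_add]; ring
        _ ≤ Real.exp (-(1/4) * ‖z' - y‖ ^ 2) * L := by
            refine mul_le_mul (Real.exp_le_exp.2 ?_) (hpt y) (by positivity) (Real.exp_pos _).le
            nlinarith [sq_nonneg ‖z' - y‖]
    have h2 := hinv z _ hgi
    rw [hfu z] at h2
    have hexp : Real.exp (N * ‖z‖) * W T ‖z‖ ≤ Real.exp (N ^ 2) * Real.exp (‖z‖ ^ 2 / 2) := by
      calc _ ≤ Real.exp (N * ‖z‖) * Real.exp (a * ‖z‖ ^ 2) := by
            gcongr
            exact min_le_left _ _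
        _ ≤ _ := by
            rw [← Real.exp_add, ← Real.exp_add]
            apply Real.exp_le_exp.2
            nlinarith [sq_nonneg (N - ‖z‖ / 2), sq_nonneg ‖z‖, sq_nonneg N]
    have hE : 0 < Real.exp (‖z‖ ^ 2 / 2) := Real.exp_pos _
    apply le_of_mul_le_mul_right _ hE
    calc W T ‖z‖ * ‖u z‖ * Real.exp (‖z‖ ^ 2 / 2) = W T ‖z‖ * (‖u z‖ * Real.exp (‖z‖ ^ 2 / 2)) := by ring
      _ ≤ W T ‖z‖ * (A * (Real.pi⁻¹ * Real.exp (‖z‖ ^ 2 / 2) * (I0 * L / W T ‖z‖)) +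
          B * Real.exp (N * ‖z‖)) := by gcongr
      _ = A1 * L * Real.exp (‖z‖ ^ 2 / 2) + B * (Real.exp (N * ‖z‖) * W T ‖z‖) := by
          rw [hA1]; field_simp
      _ ≤ A1 * L * Real.exp (‖z‖ ^ 2 / 2) + B * (Real.exp (N ^ 2) * Real.exp (‖z‖ ^ 2 / 2)) := by
          gcongr
      _ = _ := by rw [hK', hL]; ring
  have hind : ∀ j : ℕ, ∀ z, W (2 ^ j) ‖z‖ * ‖u z‖ ≤ 2 * K := by
    intro j
    induction j with
    | zero =>
      intro z
      have h1 : W (2 ^ 0) ‖z‖ ≤ 1 := by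
        simp only [hW, pow_zero]; exact min_le_right _ _
      have h2 : W (2 ^ 0) ‖z‖ * ‖u z‖ ≤ 1 * M := by
        gcongr
        exact hM z
      linarith
    | succ j ih =>
      intro z
      have hT : (1:ℝ) ≤ 2 ^ (j + 1) := one_le_pow₀ (by norm_num)
      have h1 : ∀ z, W (2 ^ (j + 1)) ‖z‖ * ‖u z‖ ≤ 4 * K := by
        intro z
        have h2 : W (2 ^ (j + 1)) ‖z‖ ≤ 2 * W (2 ^ j) ‖z‖ := by
          simp only [hW]
          rw [mul_min_of_nonneg _ _ (by norm_num : (0:ℝ) ≤ 2), pow_succ (2:ℝ) j, mul_comm (2 ^ j : ℝ) 2]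
          apply min_le_min_right
          linarith [Real.exp_pos (a * ‖z‖ ^ 2)]
        have h3 := ih z
        nlinarith [norm_nonneg (u z)]
      have h4 := hstep _ _ hT h1 z
      linarith
  refine ⟨1 - 2 * a, 2 * K, by linarith, by linarith, by positivity, fun z => ?_⟩
  obtain ⟨j, hj⟩ := pow_unbounded_of_one_lt (Real.exp (a * ‖z‖ ^ 2)) (one_lt_two : (1:ℝ) < 2)
  have h1 := hind j z
  simp only [hW] at h1
  rw [min_eq_left hj.le] at h1
  rw [hfu]
  calc ‖u z‖ * Real.exp (‖z‖ ^ 2 / 2) = (Real.exp (a * ‖z‖ ^ 2) * ‖u z‖) *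
        Real.exp ((1 - 2 * a) * ‖z‖ ^ 2 / 2) := by
        rw [show ‖z‖ ^ 2 / 2 = a * ‖z‖ ^ 2 + (1 - 2 * a) * ‖z‖ ^ 2 / 2 by ring, Real.exp_add]; ring
    _ ≤ _ := by gcongr

set_option maxHeartbeats 1600000 in
lemma iterate_bound (f g : ℂ → ℂ) (A B N : ℝ) (hA : 0 < A) (hB : 0 ≤ B)
    (hinv : ∀ (z : ℂ) (G : ℝ), (∀ z' : ℂ, ‖z'‖ = ‖z‖ → ‖g z'‖ ≤ G) →
      ‖f z‖ ≤ A * G + B * Real.exp (N * ‖z‖))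
    (hcub : ∀ η : ℝ, 0 < η → ∃ D : ℝ, 0 < D ∧ ∀ β C : ℝ, 0 < β → β < 1 → 0 ≤ C →
      β ^ 2 / 2 + η < 1 → (∀ w, ‖f w‖ ≤ C * Real.exp (β * ‖w‖ ^ 2 / 2)) → ∀ z : ℂ,
      ‖g z‖ ≤ D * C ^ 3 * Real.exp (β * ‖z‖ ^ 2 / (4 * (1 - β ^ 2 / 2 - η))))
    (β₀ σ η C : ℝ) (hβ0 : 0 < β₀) (hβ1 : β₀ < 1) (hσ : 1 / 3 ≤ σ) (hσ1 : σ < 1) (hη : 0 < η)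
    (hση : 1 ≤ σ * (2 - β₀ ^ 2 - 2 * η))
    (hb : ∀ w, ‖f w‖ ≤ C * Real.exp (β₀ * ‖w‖ ^ 2 / 2)) :
    ∃ L : ℝ, 0 ≤ L ∧ ∀ (k : ℕ) (z : ℂ), ‖f z‖ ≤ Real.exp (3 ^ k * L + σ ^ k * β₀ * ‖z‖ ^ 2 / 2) := by
  obtain ⟨D, hD, hcub⟩ := hcub η hη
  set E := Real.log (A * D + B + 1) with hE
  have hAD : 0 < A * D := by positivity
  have hE0 : 0 ≤ E := Real.log_nonneg (by linarith)
  have hexpE : Real.exp E = A * D + B + 1 := Real.exp_log (by linarith)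
  set L0 := Real.log (|C| + 1) with hL0
  have hL00 : 0 ≤ L0 := Real.log_nonneg (by linarith [abs_nonneg C])
  have hexpL0 : Real.exp L0 = |C| + 1 := Real.exp_log (by positivity)
  set L := L0 + N ^ 2 / (2 * β₀) + 3 * E with hL
  have hN2 : 0 ≤ N ^ 2 / (2 * β₀) := by positivity
  have hσ0 : 0 < σ := by linarith
  have main : ∀ (k : ℕ) (z : ℂ), ‖f z‖ ≤ Real.exp (3 ^ k * L - E) * Real.exp (σ ^ k * β₀ * ‖z‖ ^ 2 / 2) := by
    intro k
    induction k with
    | zero =>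
      intro z
      refine (hb z).trans ?_
      simp only [pow_zero, one_mul]
      gcongr
      calc C ≤ |C| + 1 := by linarith [le_abs_self C]
        _ = Real.exp L0 := hexpL0.symm
        _ ≤ _ := Real.exp_le_exp.2 (by linarith)
    | succ k ih =>
      intro z
      have hk0 : 0 < σ ^ k := by positivity
      have hk1 : σ ^ k ≤ 1 := pow_le_one₀ hσ0.le hσ1.le
      set β := σ ^ k * β₀ with hβ
      have hβp : 0 < β := by positivity
      have hββ : β ≤ β₀ := by nlinarith
      have hβ2 : β ^ 2 ≤ β₀ ^ 2 := by gcongr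
      have h2 : 1 ≤ σ * (2 - β ^ 2 - 2 * η) := by nlinarith
      have h3 : 0 < 2 - β ^ 2 - 2 * η := by
        by_contra h
        push Not at h
        nlinarith
      set l := 3 ^ k * L - E with hl
      have hcz := hcub β (Real.exp l) hβp (by linarith) (Real.exp_pos _).le (by linarith) ih
      set β' := σ ^ (k + 1) * β₀ with hβ'
      have hβ'σ : β' = σ * β := by rw [hβ', hβ, pow_succ]; ring
      have hβ'p : 0 < β' := by positivity
      have h4 : ‖f z‖ ≤ A * (D * Real.exp l ^ 3 * Real.exp (β' * ‖z‖ ^ 2 / 2)) + B * Real.exp (N * ‖z‖) := by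
        apply hinv
        intro z' hz'
        refine (hcz z').trans ?_
        rw [hz']
        gcongr ?_ * Real.exp ?_
        rw [div_le_div_iff₀ (by linarith) (by norm_num), hβ'σ]
        have : β * ‖z‖ ^ 2 * 2 * 1 ≤ β * ‖z‖ ^ 2 * 2 * (σ * (2 - β ^ 2 - 2 * η)) := by gcongr
        nlinarith
      have h5 : Real.exp (N * ‖z‖) ≤ Real.exp l ^ 3 * Real.exp (β' * ‖z‖ ^ 2 / 2) := by
        rw [← Real.exp_nat_mul, ← Real.exp_add]
        apply Real.exp_le_exp.2
        have h6 : N * ‖z‖ ≤ N ^ 2 / (2 * β') + β' * ‖z‖ ^ 2 / 2 := by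
          have : N ^ 2 / (2 * β') + β' * ‖z‖ ^ 2 / 2 - N * ‖z‖ = (N - β' * ‖z‖) ^ 2 / (2 * β') := by
            field_simp; ring
          have h7 : 0 ≤ (N - β' * ‖z‖) ^ 2 / (2 * β') := by positivity
          linarith
        have h8 : N ^ 2 / (2 * β') ≤ 3 ^ (k + 1) * (N ^ 2 / (2 * β₀)) := by
          have h9 : (1:ℝ) ≤ 3 ^ (k + 1) * σ ^ (k + 1) := by
            rw [← mul_pow]; exact one_le_pow₀ (by linarith)
          rw [div_le_iff₀ (by positivity), hβ']
          have : 3 ^ (k + 1) * (N ^ 2 / (2 * β₀)) * (2 * (σ ^ (k + 1) * β₀)) =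
            N ^ 2 * (3 ^ (k + 1) * σ ^ (k + 1)) := by field_simp
          rw [this]
          nlinarith [sq_nonneg N]
        have h10 : (1:ℝ) ≤ 3 ^ (k + 1) := one_le_pow₀ (by norm_num)
        have h11 : (3:ℝ) ^ (k + 1) * (N ^ 2 / (2 * β₀)) + 3 * E ≤ 3 ^ (k + 1) * L := by
          have ha : 3 * E ≤ 3 ^ (k + 1) * (3 * E) := le_mul_of_one_le_left (by linarith) h10
          have hb : 0 ≤ (3:ℝ) ^ (k + 1) * L0 := by positivity
          rw [hL, mul_add, mul_add]; linarith
        have h12 : ((3:ℕ):ℝ) * l = 3 ^ (k + 1) * L - 3 * E := by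
          rw [hl, pow_succ]; push_cast; ring
        rw [h12]
        linarith
      have h13 : Real.exp l ^ 3 * (A * D + B + 1) ≤ Real.exp (3 ^ (k + 1) * L - E) := by
        rw [← hexpE, ← Real.exp_nat_mul, ← Real.exp_add]
        apply Real.exp_le_exp.2
        rw [hl, pow_succ]; push_cast; linarith
      have hX : 0 < Real.exp (β' * ‖z‖ ^ 2 / 2) := Real.exp_pos _
      have hY : 0 < Real.exp l ^ 3 := by positivity
      calc ‖f z‖ ≤ A * (D * Real.exp l ^ 3 * Real.exp (β' * ‖z‖ ^ 2 / 2)) +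
            B * (Real.exp l ^ 3 * Real.exp (β' * ‖z‖ ^ 2 / 2)) := h4.trans (by gcongr)
        _ ≤ (Real.exp l ^ 3 * (A * D + B + 1)) * Real.exp (β' * ‖z‖ ^ 2 / 2) := by
            nlinarith [mul_pos hX hY]
        _ ≤ _ := by gcongr
  refine ⟨L, by positivity, fun k z => (main k z).trans ?_⟩
  rw [← Real.exp_add]
  exact Real.exp_le_exp.2 (by linarith)

lemma two_phase (f g : ℂ → ℂ) (A B N : ℝ) (hA : 0 < A) (hB : 0 ≤ B)
    (hinv : ∀ (z : ℂ) (G : ℝ), (∀ z' : ℂ, ‖z'‖ = ‖z‖ → ‖g z'‖ ≤ G) →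
      ‖f z‖ ≤ A * G + B * Real.exp (N * ‖z‖))
    (hcub : ∀ η : ℝ, 0 < η → ∃ D : ℝ, 0 < D ∧ ∀ β C : ℝ, 0 < β → β < 1 → 0 ≤ C →
      β ^ 2 / 2 + η < 1 → (∀ w, ‖f w‖ ≤ C * Real.exp (β * ‖w‖ ^ 2 / 2)) → ∀ z : ℂ,
      ‖g z‖ ≤ D * C ^ 3 * Real.exp (β * ‖z‖ ^ 2 / (4 * (1 - β ^ 2 / 2 - η))))
    (β C : ℝ) (hβ0 : 0 < β) (hβ1 : β < 1)
    (hb : ∀ w, ‖f w‖ ≤ C * Real.exp (β * ‖w‖ ^ 2 / 2)) (σ : ℝ) (hσ : 1 / 2 < σ) (hσ1 : σ < 1) :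
    ∃ L β₀ : ℝ, 0 ≤ L ∧ 0 < β₀ ∧ ∀ (k : ℕ) (z : ℂ),
      ‖f z‖ ≤ Real.exp (3 ^ k * L + σ ^ k * β₀ * ‖z‖ ^ 2 / 2) := by
  have hβ2 : β ^ 2 < 1 := by nlinarith
  have hs1 : 2 / (3 - β ^ 2) < 1 := by rw [div_lt_one (by linarith)]; linarith
  have hs3 : 1 / 3 ≤ 2 / (3 - β ^ 2) := by
    rw [div_le_div_iff₀ (by norm_num) (by linarith)]; nlinarith
  obtain ⟨L1, -, h1⟩ := iterate_bound f g A B N hA hB hinv hcub β (2 / (3 - β ^ 2)) ((1 - β ^ 2) / 4) C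
    hβ0 hβ1 hs3 hs1 (by linarith) (by
      have : 3 - β ^ 2 ≠ 0 := by linarith
      have h : 2 / (3 - β ^ 2) * (2 - β ^ 2 - 2 * ((1 - β ^ 2) / 4)) = 1 := by
        field_simp; ring
      rw [h]) hb
  set δ := 2 - 1 / σ with hδ
  have hσ0 : 0 < σ := by linarith
  have hδ0 : 0 < δ := by
    rw [hδ, sub_pos, div_lt_iff₀ hσ0]; linarith
  obtain ⟨k, hk⟩ := exists_pow_lt_of_lt_one (show 0 < δ / 2 by linarith) hs1
  set s := 2 / (3 - β ^ 2) with hs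
  have hs0 : 0 < s := by linarith
  have hsk : 0 < s ^ k := by positivity
  have hsk1 : s ^ k ≤ 1 := pow_le_one₀ hs0.le hs1.le
  have hb1 : s ^ k * β < 1 := by nlinarith
  have hb2 : s ^ k * β ≤ δ / 2 := by nlinarith
  have hb0 : 0 < s ^ k * β := by positivity
  obtain ⟨L, hL, h2⟩ := iterate_bound f g A B N hA hB hinv hcub (s ^ k * β) σ (δ / 4) (Real.exp (3 ^ k * L1))
    hb0 hb1 (by linarith) hσ1 (by linarith) (by
      have : (s ^ k * β) ^ 2 ≤ δ / 2 := by nlinarith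
      have h3 : σ * (2 - δ) = 1 := by rw [hδ]; field_simp; ring
      nlinarith) (fun w => by rw [← Real.exp_add]; exact h1 k w)
  exact ⟨L, s ^ k * β, hL, hb0, h2⟩

lemma final_choice (f : ℂ → ℂ)
    (h : ∀ σ : ℝ, 1 / 2 < σ → σ < 1 → ∃ L β₀ : ℝ, 0 ≤ L ∧ 0 < β₀ ∧ ∀ (k : ℕ) (z : ℂ),
      ‖f z‖ ≤ Real.exp (3 ^ k * L + σ ^ k * β₀ * ‖z‖ ^ 2 / 2))
    (η : ℝ) (hη : η > (1 / 2 + (1 / 2) * (Real.log 2 / Real.log 3))⁻¹) :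
    ∃ C : ℝ, 0 < C ∧ ∀ z : ℂ, ‖f z‖ ≤ C * Real.exp (‖z‖ ^ η) := by
  have hl2 : 0 < Real.log 2 := Real.log_pos (by norm_num)
  have hl3 : 0 < Real.log 3 := Real.log_pos (by norm_num)
  have hη0 : 0 < η := lt_trans (by positivity) hη
  have hkey : 2 * Real.log 3 / η < Real.log 3 + Real.log 2 := by
    have h1 : η⁻¹ < 1 / 2 + (1 / 2) * (Real.log 2 / Real.log 3) := by
      rw [gt_iff_lt] at hη
      exact inv_lt_of_inv_lt₀ (by positivity) hη
    calc 2 * Real.log 3 / η = 2 * Real.log 3 * η⁻¹ := by rw [div_eq_mul_inv]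
      _ < 2 * Real.log 3 * (1 / 2 + (1 / 2) * (Real.log 2 / Real.log 3)) := by gcongr
      _ = _ := by field_simp
  obtain ⟨t, ht1, ht2⟩ := exists_between (max_lt hkey (show Real.log 3 < Real.log 3 + Real.log 2 by linarith))
  have ht3 : Real.log 3 < t := lt_of_le_of_lt (le_max_right _ _) ht1
  have ht4 : 2 * Real.log 3 / η < t := lt_of_le_of_lt (le_max_left _ _) ht1
  have ht0 : 0 < t := by linarith
  have het : 0 < Real.exp t := Real.exp_pos t
  have het3 : 3 < Real.exp t := by
    rw [← Real.log_lt_iff_lt_exp (by norm_num)]; exact ht3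
  have het6 : Real.exp t < 6 := by
    rw [← Real.lt_log_iff_exp_lt (by norm_num), show (6:ℝ) = 3 * 2 by norm_num,
      Real.log_mul (by norm_num) (by norm_num)]; exact ht2
  obtain ⟨L, β₀, hL, hβ₀, hb⟩ := h (3 / Real.exp t) (by rw [div_lt_div_iff₀ (by norm_num) het]; linarith)
    (by rw [div_lt_one het]; exact het3)
  set p := 2 * Real.log 3 / t with hp
  have hp0 : 0 < p := by positivity
  have hpη : p < η := by
    rw [hp, div_lt_iff₀ ht0]; rw [div_lt_iff₀ hη0] at ht4; linarith
  set L' := L + β₀ * Real.exp t / 2 with hL'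
  have hL'0 : 0 < L' := by positivity
  have hmain : ∀ z : ℂ, 1 ≤ ‖z‖ → ‖f z‖ ≤ Real.exp (L' * ‖z‖ ^ p) := by
    intro z hz
    set r := ‖z‖ with hr
    have hr0 : 0 < r := by linarith
    have hlr : 0 ≤ Real.log r := Real.log_nonneg hz
    set k := ⌊2 * Real.log r / t⌋₊ with hk
    have hk1 : (k:ℝ) ≤ 2 * Real.log r / t := Nat.floor_le (by positivity)
    have hk2 : 2 * Real.log r / t < k + 1 := Nat.lt_floor_add_one _
    rw [le_div_iff₀ ht0] at hk1
    rw [div_lt_iff₀ ht0] at hk2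
    refine (hb k z).trans (Real.exp_le_exp.2 ?_)
    have h3k : (3:ℝ) ^ k ≤ r ^ p := by
      rw [Real.rpow_def_of_pos hr0, ← Real.rpow_natCast, Real.rpow_def_of_pos (by norm_num : (0:ℝ) < 3)]
      apply Real.exp_le_exp.2
      have : Real.log r * p = Real.log 3 * (2 * Real.log r / t) := by rw [hp]; ring
      rw [this]
      gcongr
      rw [le_div_iff₀ ht0]; exact hk1
    have hr2 : r ^ 2 ≤ Real.exp t ^ k * Real.exp t := by
      rw [← Real.exp_nat_mul, ← Real.exp_add]
      calc r ^ 2 = Real.exp (2 * Real.log r) := by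
            rw [show 2 * Real.log r = Real.log r + Real.log r by ring, Real.exp_add, Real.exp_log hr0]; ring
        _ ≤ _ := Real.exp_le_exp.2 (by linarith)
    have h4 : (3 / Real.exp t) ^ k * β₀ * r ^ 2 / 2 ≤ 3 ^ k * (β₀ * Real.exp t / 2) := by
      calc _ ≤ (3 / Real.exp t) ^ k * β₀ * (Real.exp t ^ k * Real.exp t) / 2 := by gcongr
        _ = _ := by rw [div_pow]; field_simp
    calc 3 ^ k * L + (3 / Real.exp t) ^ k * β₀ * r ^ 2 / 2 ≤ 3 ^ k * L + 3 ^ k * (β₀ * Real.exp t / 2) := by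
          linarith
      _ = L' * 3 ^ k := by rw [hL']; ring
      _ ≤ L' * r ^ p := by gcongr
  set R := max 1 (L' ^ (η - p)⁻¹) with hR
  have hR1 : 1 ≤ R := le_max_left _ _
  have hηp : 0 < η - p := by linarith
  have hLR : L' ≤ R ^ (η - p) := by
    calc L' = (L' ^ (η - p)⁻¹) ^ (η - p) := by
          rw [← Real.rpow_mul hL'0.le, inv_mul_cancel₀ hηp.ne', Real.rpow_one]
      _ ≤ _ := by
          apply Real.rpow_le_rpow (by positivity) (le_max_right _ _) hηp.le
  refine ⟨Real.exp (L' * R ^ p), Real.exp_pos _, fun z => ?_⟩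
  rw [← Real.exp_add]
  have hzη : 0 ≤ ‖z‖ ^ η := by positivity
  have hRp : 1 ≤ R ^ p := Real.one_le_rpow hR1 hp0.le
  rcases le_total ‖z‖ 1 with hz | hz
  · refine (hb 0 z).trans (Real.exp_le_exp.2 ?_)
    have h1 : ‖z‖ ^ 2 ≤ 1 := pow_le_one₀ (norm_nonneg _) hz
    have h2 : β₀ * ‖z‖ ^ 2 ≤ β₀ * Real.exp t := by
      gcongr; linarith
    have h3 : L' ≤ L' * R ^ p := by nlinarith
    simp only [pow_zero, one_mul]
    rw [hL'] at h3 ⊢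
    linarith
  · refine (hmain z hz).trans (Real.exp_le_exp.2 ?_)
    have hz0 : 0 < ‖z‖ := by linarith
    rcases le_total ‖z‖ R with hzR | hzR
    · have : ‖z‖ ^ p ≤ R ^ p := Real.rpow_le_rpow hz0.le hzR hp0.le
      nlinarith
    · have h1 : L' ≤ ‖z‖ ^ (η - p) := hLR.trans (Real.rpow_le_rpow (by linarith) hzR hηp.le)
      have h2 : L' * ‖z‖ ^ p ≤ ‖z‖ ^ (η - p) * ‖z‖ ^ p := by gcongr
      rw [← Real.rpow_add hz0, sub_add_cancel] at h2
      have : 0 ≤ L' * R ^ p := by positivity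
      linarith

lemma repro (f : ℂ → ℂ) (hf : Differentiable ℂ f) (u : ℂ → ℂ)
    (hu : ∀ z : ℂ, u z = f z * Complex.exp (-(‖z‖ : ℂ) ^ 2 / 2)) (M : ℝ)
    (hM : ∀ z, ‖u z‖ ≤ M) (z : ℂ) : LLLProj u z = u z := by
  have hfc := hf.continuous
  set F : ℂ → ℂ := fun s => Complex.exp (-(s * (starRingEnd ℂ) z) - (‖s‖ : ℂ) ^ 2) * f (z + s) with hF
  have hnu : ∀ w : ℂ, ‖f w‖ = ‖u w‖ * Real.exp (‖w‖ ^ 2 / 2) := by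
    intro w
    rw [hu, norm_mul, Complex.norm_exp, mul_assoc, ← Real.exp_add]
    have : (-(‖w‖ : ℂ) ^ 2 / 2).re = -(‖w‖ ^ 2 / 2) := by
      rw [show (-(‖w‖ : ℂ) ^ 2 / 2) = ((-(‖w‖ ^ 2 / 2) : ℝ) : ℂ) by push_cast; ring, Complex.ofReal_re]
    rw [this]; simp
  have hFc : Continuous F := by rw [hF]; fun_prop
  have h1 : ∫ w : ℂ, Complex.exp ((starRingEnd ℂ) w * z - (‖w‖ : ℂ) ^ 2 / 2) * u w = ∫ s, F s := by
    rw [← integral_add_left_eq_self _ z]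
    congr 1
    ext s
    rw [hu, hF]
    simp only
    rw [mul_comm (f (z + s)), ← mul_assoc, ← Complex.exp_add]
    congr 2
    have h2 : ∀ w : ℂ, (‖w‖ : ℂ) ^ 2 = w * (starRingEnd ℂ) w := fun w => by
      rw [Complex.mul_conj, Complex.normSq_eq_norm_sq]; push_cast; rfl
    have h3 := h2 (z + s)
    rw [map_add] at h3
    rw [map_add]
    linear_combination -h3 + h2 s
  have hFi : Integrable F := by
    refine Integrable.mono' ((gauss_int (show (0:ℝ) < 1 / 2 by norm_num)).const_mul
      (M * Real.exp (‖z‖ ^ 2 / 2))) hFc.aestronglyMeasurable (Filter.Eventually.of_forall fun s => ?_)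
    rw [hF]
    simp only
    rw [norm_mul, Complex.norm_exp, hnu]
    have h2 : (-(s * (starRingEnd ℂ) z) - (‖s‖ : ℂ) ^ 2).re + ‖z + s‖ ^ 2 / 2 =
        ‖z‖ ^ 2 / 2 + -(1 / 2) * ‖s‖ ^ 2 := by
      simp only [← Complex.normSq_eq_norm_sq]
      rw [← Complex.ofReal_pow, ← Complex.normSq_eq_norm_sq]
      simp [Complex.normSq_apply]; ring
    calc _ = ‖u (z + s)‖ * Real.exp ((-(s * (starRingEnd ℂ) z) - (‖s‖ : ℂ) ^ 2).re + ‖z + s‖ ^ 2 / 2) := by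
          rw [Real.exp_add]; ring
      _ ≤ M * Real.exp (‖z‖ ^ 2 / 2 + -(1 / 2) * ‖s‖ ^ 2) := by
          rw [h2]; gcongr; exact hM _
      _ = _ := by rw [Real.exp_add]; ring
  have h4 : ∫ s, F s = Real.pi * f z := by
    rw [polar_avg F hFc hFi]
    have h5 : ∀ r ∈ Set.Ioi (0:ℝ), (2 * Real.pi * r : ℝ) • Real.circleAverage F 0 r =
        ((r : ℂ) * Complex.exp (-1 * (r:ℂ) ^ 2)) * (2 * Real.pi * f z) := by
      intro r hr
      set h : ℂ → ℂ := fun s => Complex.exp (-(r:ℂ) ^ 2) • (Complex.exp (-(s * (starRingEnd ℂ) z)) * f (z + s)) with hh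
      have h6 : Real.circleAverage F 0 r = Real.circleAverage h 0 r := by
        apply Real.circleAverage_congr_sphere
        intro s hs
        have : ‖s‖ = r := by
          rw [mem_sphere_zero_iff_norm] at hs; rw [hs, abs_of_pos hr]
        simp only [hF, hh, this, smul_eq_mul]
        rw [← mul_assoc, ← Complex.exp_add]
        congr 2; ring
      have h7 : Real.circleAverage h 0 r = h 0 := by
        apply DiffContOnCl.circleAverage
        apply Differentiable.diffContOnCl
        rw [hh]
        fun_prop
      rw [h6, h7, hh]
      simp
      ring
    rw [setIntegral_congr_fun measurableSet_Ioi h5, integral_mul_const,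
      integral_mul_cexp_neg_mul_sq (by simp)]
    ring
  rw [LLLProj, h1, h4, hu]
  have : (Real.pi : ℂ) ≠ 0 := by exact_mod_cast Real.pi_ne_zero
  field_simp

lemma exp_norm_int {ε : ℝ} (hε : 0 < ε) : Integrable (fun w : ℂ => Real.exp (-ε * ‖w‖)) := by
  have h := (integrable_fun_norm_addHaar (E := ℂ) (F := ℝ) volume
    (f := fun r => Real.exp (-ε * r))).2
  apply h
  have h2 := integrableOn_rpow_mul_exp_neg_mul_rpow (p := 1) (s := 1) (b := ε) (by norm_num) (by norm_num) hε
  refine h2.congr_fun (fun r _ => ?_) measurableSet_Ioi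
  simp [Complex.finrank_real_complex]

lemma weight_diff {ε a b d : ℝ} (hε : 0 < ε) (hε1 : ε ≤ 1) (hd : |a - b| ≤ d) :
    |Real.exp (-ε * a) - Real.exp (-ε * b)| ≤ ε * (d * Real.exp d) * Real.exp (-ε * a) := by
  have hd0 : 0 ≤ d := (abs_nonneg _).trans hd
  have h1 : Real.exp (-ε * a) - Real.exp (-ε * b) =
      Real.exp (-ε * a) * (1 - Real.exp (ε * (a - b))) := by
    rw [mul_sub, ← Real.exp_add, mul_one]; congr 2; ring
  have h2 : |1 - Real.exp (ε * (a - b))| ≤ ε * (d * Real.exp d) := by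
    set x := ε * (a - b) with hx
    have hxd : |x| ≤ ε * d := by rw [hx, abs_mul, abs_of_pos hε]; gcongr
    have hxd' : |x| ≤ d := hxd.trans (by nlinarith)
    have h3 : |1 - Real.exp x| ≤ |x| * Real.exp |x| := by
      rcases le_total 0 x with h0 | h0
      · have h4 : 1 ≤ Real.exp x := Real.one_le_exp h0
        rw [abs_of_nonneg h0, abs_sub_comm, abs_of_nonneg (by linarith)]
        have h5 := Real.add_one_le_exp (-x)
        have h6 : Real.exp (-x) * Real.exp x = 1 := by rw [← Real.exp_add]; simp
        nlinarith [Real.exp_pos x]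
      · have h4 : Real.exp x ≤ 1 := Real.exp_le_one_iff.2 h0
        rw [abs_of_nonpos h0, abs_of_nonneg (by linarith)]
        have h5 := Real.add_one_le_exp x
        have h6 : 1 ≤ Real.exp (-x) := Real.one_le_exp (by linarith)
        nlinarith
    calc _ ≤ |x| * Real.exp |x| := h3
      _ ≤ (ε * d) * Real.exp d := by gcongr
      _ = _ := by ring
  rw [h1, abs_mul, abs_of_pos (Real.exp_pos _), mul_comm]
  gcongr

lemma gauss_absorb (d : ℝ) :
    d * Real.exp d * Real.exp (-(1/2) * d ^ 2) ≤ Real.exp 4 * Real.exp (-(1/4) * d ^ 2) := by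
  have h1 : d ≤ Real.exp d := by linarith [Real.add_one_le_exp d]
  calc _ ≤ Real.exp d * Real.exp d * Real.exp (-(1/2) * d ^ 2) := by gcongr
    _ ≤ _ := by
      rw [← Real.exp_add, ← Real.exp_add, ← Real.exp_add]
      apply Real.exp_le_exp.2
      nlinarith [sq_nonneg (d - 4)]

set_option maxHeartbeats 1600000 in
lemma zero_case (f : ℂ → ℂ) (hf : Differentiable ℂ f) (u : ℂ → ℂ)
    (hu : ∀ z : ℂ, u z = f z * Complex.exp (-(‖z‖ : ℂ) ^ 2 / 2)) (M : ℝ)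
    (hM : ∀ z, ‖u z‖ ≤ M)
    (h0 : ∀ z : ℂ, LLLProj (fun w : ℂ => (‖u w‖ : ℂ) ^ 2 * u w) z = 0) (z₀ : ℂ) : u z₀ = 0 := by
  have hfc := hf.continuous
  have huc : Continuous u := by
    rw [show u = fun z => f z * Complex.exp (-(‖z‖ : ℂ) ^ 2 / 2) from funext hu]
    fun_prop
  have hM0 : 0 ≤ M := (norm_nonneg _).trans (hM 0)
  have hpi := Real.pi_pos
  have hpiC : (Real.pi : ℂ) ≠ 0 := by exact_mod_cast Real.pi_ne_zero
  set H : ℂ → ℝ := fun s => Real.exp 4 * Real.exp (-(1/4) * ‖s‖ ^ 2) with hH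
  have hHi : Integrable H := (gauss_int (by norm_num)).const_mul _
  set I := ∫ s, H s with hI
  have hI0 : 0 ≤ I := integral_nonneg fun s => by positivity
  set ε : ℝ := 1 / (4 * I + 1) with hε
  have hε0 : 0 < ε := by positivity
  have hε1 : ε ≤ 1 := by rw [hε, div_le_one (by positivity)]; linarith
  have hεI : 2 * ε * I ≤ 1 / 2 := by
    rw [hε]; rw [mul_one_div, div_mul_eq_mul_div, div_le_div_iff₀ (by positivity) (by norm_num)]; linarith
  set w : ℂ → ℝ := fun z => Real.exp (-ε * ‖z‖) with hw
  have hwi : Integrable w := exp_norm_int hε0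
  have hwp : ∀ z, 0 < w z := fun z => Real.exp_pos _
  have hwc : Continuous w := by rw [hw]; fun_prop
  set φ : ℂ → ℝ := fun z => w z * ‖u z‖ ^ 4 with hφ
  have hφc : Continuous φ := by rw [hφ]; fun_prop
  have hφ0 : ∀ z, 0 ≤ φ z := fun z => by rw [hφ]; have := hwp z; positivity
  have hφi : Integrable φ := by
    refine Integrable.mono' (hwi.mul_const (M ^ 4)) hφc.aestronglyMeasurable
      (Filter.Eventually.of_forall fun z => ?_)
    rw [Real.norm_of_nonneg (hφ0 z)]
    have := (hwp z).le
    have := hM z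
    simp only [hφ]
    gcongr
  set J := ∫ z, φ z with hJ
  have hJ0 : 0 ≤ J := integral_nonneg hφ0
  set k : ℂ → ℂ → ℂ := fun y z => Complex.exp (-(‖y‖ : ℂ) ^ 2 / 2) *
    Complex.exp ((starRingEnd ℂ) z * y - (‖z‖ : ℂ) ^ 2 / 2) with hk
  have hknorm : ∀ y z, ‖k y z‖ = Real.exp (-(1/2) * ‖y - z‖ ^ 2) := by
    intro y z
    simp only [hk]
    rw [← Complex.exp_add, Complex.norm_exp]
    congr 1
    rw [← Complex.ofReal_pow, ← Complex.ofReal_pow, ← Complex.normSq_eq_norm_sq,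
      ← Complex.normSq_eq_norm_sq, ← Complex.normSq_eq_norm_sq]
    simp [Complex.normSq_apply]; ring
  have hkconj : ∀ y z, (starRingEnd ℂ) (k y z) = k z y := by
    intro y z
    simp only [hk]
    rw [← Complex.exp_add, ← Complex.exp_add, ← Complex.exp_conj]
    congr 1
    have h2 : (starRingEnd ℂ) (2 : ℂ) = 2 := Complex.conj_ofNat 2
    simp only [map_add, map_sub, map_mul, map_div₀, map_neg, map_pow, Complex.conj_ofReal,
      Complex.conj_conj, h2]
    ring
  have hkc : Continuous (fun p : ℂ × ℂ => k p.1 p.2) := by rw [hk]; fun_prop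
  have hLLL : ∀ (v : ℂ → ℂ) (y : ℂ), ∫ z, k y z * v z = Real.pi * LLLProj v y := by
    intro v y
    rw [LLLProj, ← mul_assoc, ← mul_assoc, mul_inv_cancel₀ hpiC, one_mul, ← integral_const_mul]
    congr 1
    ext z
    simp only [hk]
    ring
  set v : ℂ → ℂ := fun w : ℂ => (‖u w‖ : ℂ) ^ 2 * u w with hv
  have hvc : Continuous v := by rw [hv]; fun_prop
  have hvn : ∀ z, ‖v z‖ = ‖u z‖ ^ 3 := fun z => by
    simp only [hv]; rw [norm_mul, norm_pow, Complex.norm_real, norm_norm]; ring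
  set G : ℂ → ℝ := fun s => Real.exp (-(1/2) * ‖s‖ ^ 2) with hG
  have hGi : Integrable G := gauss_int (by norm_num)
  have conv2 : ∀ a b : ℂ → ℝ, Integrable a → Integrable b →
      Integrable (fun p : ℂ × ℂ => a p.2 * b (p.1 - p.2)) (volume.prod volume) := fun a b ha hb =>
    Integrable.convolution_integrand (ContinuousLinearMap.mul ℝ ℝ) ha hb
  have conv1 : ∀ a b : ℂ → ℝ, (∀ s, b (-s) = b s) → Integrable a → Integrable b →
      Integrable (fun p : ℂ × ℂ => a p.1 * b (p.1 - p.2)) (volume.prod volume) := by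
    intro a b hbs ha hb
    refine (conv2 a b ha hb).swap.congr (Filter.Eventually.of_forall fun p => ?_)
    simp only [Function.comp, Prod.fst_swap, Prod.snd_swap]
    rw [← hbs, neg_sub]
  have hGs : ∀ s, G (-s) = G s := fun s => by simp only [hG, norm_neg]
  have hHs : ∀ s, H (-s) = H s := fun s => by simp only [hH, norm_neg]
  set F1 : ℂ × ℂ → ℂ := fun p => (w p.2 : ℂ) * v p.2 * (k p.1 p.2 * (starRingEnd ℂ) (u p.1)) with hF1
  set F2 : ℂ × ℂ → ℂ := fun p => (w p.1 : ℂ) * (starRingEnd ℂ) (u p.1) * (k p.1 p.2 * v p.2) with hF2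
  have hF1c : Continuous F1 := by rw [hF1]; fun_prop
  have hF2c : Continuous F2 := by rw [hF2]; fun_prop
  have hF1i : Integrable F1 (volume.prod volume) := by
    refine Integrable.mono' ((conv2 w G hwi hGi).const_mul (M ^ 4)) hF1c.aestronglyMeasurable
      (Filter.Eventually.of_forall fun p => ?_)
    simp only [hF1, norm_mul, hvn, hknorm, RCLike.norm_conj, Complex.norm_real,
      Real.norm_of_nonneg (hwp _).le]
    have h1 : ‖u p.2‖ ^ 3 * ‖u p.1‖ ≤ M ^ 3 * M := by
      have := hM p.1; have := hM p.2; gcongr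
    have h2 : 0 ≤ w p.2 * G (p.1 - p.2) := by have := hwp p.2; simp only [hG]; positivity
    simp only [hG] at h2 ⊢
    nlinarith
  have hF2i : Integrable F2 (volume.prod volume) := by
    refine Integrable.mono' ((conv1 w G hGs hwi hGi).const_mul (M ^ 4)) hF2c.aestronglyMeasurable
      (Filter.Eventually.of_forall fun p => ?_)
    simp only [hF2, norm_mul, hvn, hknorm, RCLike.norm_conj, Complex.norm_real,
      Real.norm_of_nonneg (hwp _).le]
    have h1 : ‖u p.2‖ ^ 3 * ‖u p.1‖ ≤ M ^ 3 * M := by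
      have := hM p.1; have := hM p.2; gcongr
    have h2 : 0 ≤ w p.1 * G (p.1 - p.2) := by have := hwp p.1; simp only [hG]; positivity
    simp only [hG] at h2 ⊢
    nlinarith
  have hI1 : ∫ p, F1 p ∂(volume.prod volume) = ((Real.pi * J : ℝ) : ℂ) := by
    rw [integral_prod_symm _ hF1i]
    have : ∀ z : ℂ, ∫ y : ℂ, F1 (y, z) = ((Real.pi * φ z : ℝ) : ℂ) := by
      intro z
      simp only [hF1]
      rw [integral_const_mul]
      have h1 : ∫ y : ℂ, k y z * (starRingEnd ℂ) (u y) = (starRingEnd ℂ) (∫ y : ℂ, k z y * u y) := by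
        rw [← integral_conj]
        congr 1
        ext y
        rw [map_mul, hkconj]
      rw [h1, hLLL, repro f hf u hu M hM]
      simp only [hv, hφ, map_mul, Complex.conj_ofReal]
      have h2 : u z * (starRingEnd ℂ) (u z) = (‖u z‖ : ℂ) ^ 2 := by
        rw [Complex.mul_conj, Complex.normSq_eq_norm_sq]; push_cast; rfl
      push_cast
      linear_combination (w z : ℂ) * (‖u z‖ : ℂ) ^ 2 * Real.pi * h2
    simp only [this]
    rw [integral_complex_ofReal, integral_const_mul]
  have hI2 : ∫ p, F2 p ∂(volume.prod volume) = 0 := by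
    rw [integral_prod _ hF2i]
    have : ∀ y : ℂ, ∫ z : ℂ, F2 (y, z) = 0 := by
      intro y
      simp only [hF2]
      rw [integral_const_mul, hLLL, h0]
      simp
    simp only [this, integral_zero]
  have hA := conv2 φ H hφi hHi
  have hB := conv1 φ H hHs hφi hHi
  have hA' : ∫ p : ℂ × ℂ, φ p.2 * H (p.1 - p.2) ∂(volume.prod volume) = I * J := by
    rw [integral_prod_symm _ hA]
    simp only [integral_const_mul]
    have : ∀ z : ℂ, ∫ y : ℂ, H (y - z) = I := fun z => integral_sub_right_eq_self H z
    simp only [this, integral_mul_const]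
    rw [mul_comm]
  have hB' : ∫ p : ℂ × ℂ, φ p.1 * H (p.1 - p.2) ∂(volume.prod volume) = I * J := by
    rw [integral_prod _ hB]
    simp only [integral_const_mul]
    have : ∀ z : ℂ, ∫ y : ℂ, H (z - y) = I := fun z => integral_sub_left_eq_self H volume z
    simp only [this, integral_mul_const]
    rw [mul_comm]
  have hbound : ∀ p : ℂ × ℂ, ‖F1 p - F2 p‖ ≤ ε * (φ p.2 * H (p.1 - p.2) + φ p.1 * H (p.1 - p.2)) := by
    rintro ⟨y, z⟩
    have h1 : F1 (y, z) - F2 (y, z) = ((w z - w y : ℝ) : ℂ) * (v z * (k y z * (starRingEnd ℂ) (u y))) := by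
      simp only [hF1, hF2]; push_cast; ring
    rw [h1, norm_mul, norm_mul (v z), norm_mul (k y z), hvn, hknorm, RCLike.norm_conj, Complex.norm_real,
      Real.norm_eq_abs]
    set d := ‖y - z‖ with hd
    have hd0 : 0 ≤ d := norm_nonneg _
    have hz1 : |w z - w y| ≤ ε * (d * Real.exp d) * w z := by
      apply weight_diff hε0 hε1
      rw [abs_sub_comm]; exact abs_norm_sub_norm_le y z
    have hy1 : |w z - w y| ≤ ε * (d * Real.exp d) * w y := by
      rw [abs_sub_comm]
      apply weight_diff hε0 hε1
      exact abs_norm_sub_norm_le y z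
    have habs := gauss_absorb d
    have ha := norm_nonneg (u z)
    have hb := norm_nonneg (u y)
    set a := ‖u z‖
    set b := ‖u y‖
    have hg0 : 0 < Real.exp (-(1/2) * d ^ 2) := Real.exp_pos _
    have hT : |w z - w y| * (a ^ 3 * b) ≤ ε * (d * Real.exp d) * (w z * a ^ 4 + w y * b ^ 4) := by
      have hwz := hwp z
      have hwy := hwp y
      have hc : 0 ≤ ε * (d * Real.exp d) := by positivity
      rcases le_total b a with h | h
      · calc _ ≤ (ε * (d * Real.exp d) * w z) * (a ^ 3 * a) := by gcongr
          _ ≤ _ := by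
            have : 0 ≤ ε * (d * Real.exp d) * (w y * b ^ 4) := by positivity
            nlinarith
      · calc _ ≤ (ε * (d * Real.exp d) * w y) * (b ^ 3 * b) := by gcongr
          _ ≤ _ := by
            have : 0 ≤ ε * (d * Real.exp d) * (w z * a ^ 4) := by positivity
            nlinarith
    have hS : 0 ≤ w z * a ^ 4 + w y * b ^ 4 := add_nonneg (hφ0 z) (hφ0 y)
    calc _ = (|w z - w y| * (a ^ 3 * b)) * Real.exp (-(1/2) * d ^ 2) := by ring
      _ ≤ (ε * (d * Real.exp d) * (w z * a ^ 4 + w y * b ^ 4)) * Real.exp (-(1/2) * d ^ 2) := by gcongr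
      _ = ε * (w z * a ^ 4 + w y * b ^ 4) * (d * Real.exp d * Real.exp (-(1/2) * d ^ 2)) := by ring
      _ ≤ ε * (w z * a ^ 4 + w y * b ^ 4) * (Real.exp 4 * Real.exp (-(1/4) * d ^ 2)) := by gcongr
      _ = _ := by simp only [hφ, hH]; ring
  have hfin : Real.pi * J ≤ ε * (I * J + I * J) := by
    have h1 : ‖∫ p, (F1 p - F2 p) ∂(volume.prod volume)‖ ≤
        ∫ p : ℂ × ℂ, ε * (φ p.2 * H (p.1 - p.2) + φ p.1 * H (p.1 - p.2)) ∂(volume.prod volume) :=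
      norm_integral_le_of_norm_le ((hA.add hB).const_mul ε) (Filter.Eventually.of_forall hbound)
    rw [integral_sub hF1i hF2i, hI1, hI2, sub_zero, Complex.norm_real,
      Real.norm_of_nonneg (by positivity), integral_const_mul, integral_add hA hB, hA', hB'] at h1
    exact h1
  have hJz : J = 0 := by
    have hpi3 := Real.pi_gt_three
    have : 3 * J ≤ Real.pi * J := by gcongr
    have h2 : ε * (I * J + I * J) = (2 * ε * I) * J := by ring
    have h3 : (2 * ε * I) * J ≤ (1 / 2) * J := by gcongr
    linarith
  have hae : φ =ᵐ[volume] 0 := (integral_eq_zero_iff_of_nonneg hφ0 hφi).1 hJz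
  have hφz : φ = 0 := (hφc.ae_eq_iff_eq volume continuous_const).1 hae
  have h1 := congrFun hφz z₀
  simp only [hφ, Pi.zero_apply] at h1
  rcases mul_eq_zero.1 h1 with h2 | h2
  · exact absurd h2 (hwp z₀).ne'
  · exact norm_eq_zero.1 (pow_eq_zero_iff (by norm_num) |>.1 h2)

theorem mp_stationary_wave_decay (lam mu : ℝ) (f : ℂ → ℂ) (hf : Differentiable ℂ f)
    (u : ℂ → ℂ) (hu : ∀ z : ℂ, u z = f z * Complex.exp (-(‖z‖ : ℂ) ^ 2 / 2))
    (hbd : ∃ M : ℝ, ∀ z : ℂ, ‖u z‖ ≤ M)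
    (hdecay : Filter.Tendsto u (Filter.cocompact ℂ) (nhds 0))
    (heq : ∀ z : ℂ,
      (lam : ℂ) * u z + (mu : ℂ) * (z * deriv f z * Complex.exp (-(‖z‖ : ℂ) ^ 2 / 2)) =
        LLLProj (fun w : ℂ => (‖u w‖ : ℂ) ^ 2 * u w) z) :
    ∀ η : ℝ, η > (1 / 2 + (1 / 2) * (Real.log 2 / Real.log 3))⁻¹ →
      ∃ C : ℝ, 0 < C ∧ ∀ z : ℂ, ‖u z‖ ≤ C * Real.exp (‖z‖ ^ η - ‖z‖ ^ 2 / 2) := by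
  intro η hη
  obtain ⟨M, hM⟩ := hbd
  by_cases hlm : lam = 0 ∧ mu = 0
  · obtain ⟨rfl, rfl⟩ := hlm
    have h0 := zero_case f hf u hu M hM (fun z => by rw [← heq z]; simp)
    refine ⟨1, one_pos, fun z => ?_⟩
    rw [h0 z, norm_zero]
    positivity
  have hlm' : lam ≠ 0 ∨ mu ≠ 0 := by
    rcases not_and_or.1 hlm with h | h
    · exact Or.inl h
    · exact Or.inr h
  have hpi := Real.pi_pos
  have hfc := hf.continuous
  have huc : Continuous u := by
    rw [show u = fun z => f z * Complex.exp (-(‖z‖ : ℂ) ^ 2 / 2) from funext hu]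
    fun_prop
  have hue : ∀ z, ‖u z‖ = ‖f z‖ * Real.exp (-(‖z‖ ^ 2 / 2)) := by
    intro w
    rw [hu, norm_mul, Complex.norm_exp]
    congr 2
    rw [show (-(‖w‖ : ℂ) ^ 2 / 2) = ((-(‖w‖ ^ 2 / 2) : ℝ) : ℂ) by push_cast; ring, Complex.ofReal_re]
  have hfu : ∀ z, ‖f z‖ = ‖u z‖ * Real.exp (‖z‖ ^ 2 / 2) := by
    intro w
    rw [hue, mul_assoc, ← Real.exp_add]; simp
  set g : ℂ → ℂ := fun z => (lam : ℂ) * f z + (mu : ℂ) * (z * deriv f z) with hg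
  have hgz : ∀ z, g z = (Real.pi : ℂ)⁻¹ * ∫ w : ℂ, Complex.exp ((starRingEnd ℂ) w * z - (‖w‖ : ℂ) ^ 2 / 2) *
      ((‖u w‖ : ℂ) ^ 2 * u w) := by
    intro z
    have h1 := heq z
    rw [LLLProj, hu z] at h1
    have h2 : Complex.exp (-(‖z‖ : ℂ) ^ 2 / 2) ≠ 0 := Complex.exp_ne_zero _
    apply mul_right_cancel₀ h2
    simp only [hg]
    linear_combination h1
  have hg1 : ∀ z, ‖g z‖ ≤ Real.pi⁻¹ * Real.exp (‖z‖ ^ 2 / 2) *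
      ∫ y : ℂ, Real.exp (-(1/2) * ‖z - y‖ ^ 2) * ‖u y‖ ^ 3 := by
    intro z
    rw [hgz, norm_mul, norm_inv, Complex.norm_real, Real.norm_of_nonneg hpi.le, mul_assoc,
      ← integral_const_mul]
    gcongr
    refine (norm_integral_le_integral_norm _).trans (le_of_eq ?_)
    congr 1
    ext w
    rw [norm_mul, norm_mul, norm_pow, Complex.norm_real, norm_norm, Complex.norm_exp, ← mul_assoc,
      ← mul_assoc, ← Real.exp_add, mul_assoc, ← pow_succ]
    congr 2
    rw [← Complex.ofReal_pow, ← Complex.normSq_eq_norm_sq, ← Complex.normSq_eq_norm_sq,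
      ← Complex.normSq_eq_norm_sq]
    simp [Complex.normSq_apply]; ring
  have hg2 : ∀ z, g z = (Real.pi : ℂ)⁻¹ * ∫ w : ℂ,
      Complex.exp ((starRingEnd ℂ) w * z - 2 * (‖w‖ : ℂ) ^ 2) * (f w ^ 2 * (starRingEnd ℂ) (f w)) := by
    intro z
    rw [hgz]
    congr 2
    ext w
    have h3 : (‖u w‖ : ℂ) ^ 2 = f w * (starRingEnd ℂ) (f w) * Complex.exp (-(‖w‖ : ℂ) ^ 2) := by
      rw [hue, Complex.ofReal_mul, mul_pow, Complex.mul_conj, Complex.normSq_eq_norm_sq,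
        Complex.ofReal_exp, ← Complex.exp_nat_mul]
      push_cast
      congr 2
      ring
    have h4 : Complex.exp ((starRingEnd ℂ) w * z - 2 * (‖w‖ : ℂ) ^ 2) =
        Complex.exp ((starRingEnd ℂ) w * z - (‖w‖ : ℂ) ^ 2 / 2) * Complex.exp (-(‖w‖ : ℂ) ^ 2) *
          Complex.exp (-(‖w‖ : ℂ) ^ 2 / 2) := by
      rw [← Complex.exp_add, ← Complex.exp_add]; congr 1; ring
    rw [h3, h4, hu]
    ring
  have hcub : ∀ η : ℝ, 0 < η → ∃ D : ℝ, 0 < D ∧ ∀ β C : ℝ, 0 < β → β < 1 → 0 ≤ C →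
      β ^ 2 / 2 + η < 1 → (∀ w, ‖f w‖ ≤ C * Real.exp (β * ‖w‖ ^ 2 / 2)) → ∀ z : ℂ,
      ‖g z‖ ≤ D * C ^ 3 * Real.exp (β * ‖z‖ ^ 2 / (4 * (1 - β ^ 2 / 2 - η))) := by
    intro η hη
    obtain ⟨D, hD, h⟩ := cubic_bound hη
    refine ⟨Real.pi⁻¹ * D, by positivity, fun β C h1 h2 h3 h4 h5 z => ?_⟩
    have h6 := h f hf β C h1 h2 h3 h4 h5 z
    rw [hg2, norm_mul, norm_inv, Complex.norm_real, Real.norm_of_nonneg hpi.le, mul_assoc, mul_assoc]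
    rw [mul_assoc] at h6
    gcongr
  obtain ⟨A, B, N, hA, hB, -, hinv⟩ := inversion lam mu hlm' f hf
  obtain ⟨β, C, hβ0, hβ1, -, hb⟩ := start_bound f g u huc A B N M hA hB hM hdecay hfu hinv hg1
  obtain ⟨C', hC', hfin⟩ := final_choice f (fun σ hσ hσ1 =>
    two_phase f g A B N hA hB hinv hcub β C hβ0 hβ1 hb σ hσ hσ1) η hη
  refine ⟨C', hC', fun z => ?_⟩
  rw [hue, sub_eq_add_neg, Real.exp_add, ← mul_assoc]
  gcongr
  exact hfin z
end
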